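/- arXiv:2507.16734 — 2 statements merged into one kernel-verified Lean document; each statement's English description precedes it below -/
import Mathlib

section
/- Let Γ ⊆ ℓ²(ℕ) be a compact, convex, orthosymmetric set. Then for every ε > 0, n_gof(Γ, ε/√2)² ≥ (1/(64·log(2·D_c(Γ, ε)))) · n_est(Γ, √3·ε)/ε², where D_c(Γ, ε) is the coordinate-wise Kolmogorov dimension of Γ at scale ε. -/
open MeasureTheory ProbabilityTheory Real
open scoped RealInnerProductSpace ENNReal

/-- The real Hilbert space `ℓ²(ℕ)` of square-summable sequences. -/
noncomputable abbrev SeqL2 : Type := lp (fun _ : ℕ => ℝ) 2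

/-- The joint law of `n` i.i.d. samples from `ν`. -/
noncomputable def iidSamples {E : Type*} [MeasurableSpace E] (n : ℕ) (ν : Measure E) :
    Measure (Fin n → E) :=
  Measure.pi (fun _ => ν)

/-- `ν` is the Gaussian sequence measure `N(θ, I_∞) = ⊗_{i ≥ 0} N(θ_i, 1)` on `ℝ^ℕ`:
a probability measure whose finite-dimensional marginals are the corresponding finite
product Gaussians.  (Such a measure exists and is unique.) -/
def IsGaussianSeq (θ : ℕ → ℝ) (ν : Measure (ℕ → ℝ)) : Prop :=
  IsProbabilityMeasure ν ∧
    IsProjectiveLimit ν (fun J : Finset ℕ => Measure.pi (fun j : J => gaussianReal (θ j) 1))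

/-- Goodness-of-fit sample complexity in the Gaussian sequence model, where
`G θ = N(θ, I_∞)`: the smallest `n` admitting a measurable test with both errors `≤ 1/4`. -/
noncomputable def nGofSeq (G : (ℕ → ℝ) → Measure (ℕ → ℝ)) (Γ : Set SeqL2) (ε : ℝ) : ℕ :=
  sInf {n : ℕ | ∃ ψ : (Fin n → (ℕ → ℝ)) → Bool, Measurable ψ ∧
    (iidSamples n (G 0)) {x | ψ x = true} ≤ 1/4 ∧
    ∀ θ ∈ Γ, ε ≤ ‖θ‖ → (iidSamples n (G ⇑θ)) {x | ψ x = false} ≤ 1/4}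

/-- Estimation sample complexity in the Gaussian sequence model, where `G θ = N(θ, I_∞)`:
the smallest `n` admitting a measurable estimator with worst-case expected squared
`ℓ²`-error at most `ε²` over `Γ`. -/
noncomputable def nEstSeq (G : (ℕ → ℝ) → Measure (ℕ → ℝ)) (Γ : Set SeqL2) (ε : ℝ) : ℕ :=
  sInf {n : ℕ | ∃ est : (Fin n → (ℕ → ℝ)) → (ℕ → ℝ), Measurable est ∧
    ∀ θ ∈ Γ,
      (∫⁻ x, (∑' i, ENNReal.ofReal ((est x i - θ i) ^ 2)) ∂(iidSamples n (G ⇑θ)))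
        ≤ ENNReal.ofReal (ε ^ 2)}

/-- `(m, n)` is LFHT-feasible for `Γ ⊆ ℓ²(ℕ)` at separation `ε` in the Gaussian sequence
model, where `G θ = N(θ, I_∞)`. -/
def LFHTFeasibleSeq (G : (ℕ → ℝ) → Measure (ℕ → ℝ)) (Γ : Set SeqL2) (ε : ℝ)
    (m n : ℕ) : Prop :=
  ∃ ψ : (Fin n → (ℕ → ℝ)) × (Fin n → (ℕ → ℝ)) × (Fin m → (ℕ → ℝ)) → Bool,
    Measurable ψ ∧
    ∀ θ1 ∈ Γ, ∀ θ2 ∈ Γ, ε ≤ ‖θ1 - θ2‖ →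
      (((iidSamples n (G ⇑θ1)).prod
          ((iidSamples n (G ⇑θ2)).prod (iidSamples m (G ⇑θ1))))
            {x | ψ x = true} ≤ 1/4 ∧
        ((iidSamples n (G ⇑θ1)).prod
          ((iidSamples n (G ⇑θ2)).prod (iidSamples m (G ⇑θ2))))
            {x | ψ x = false} ≤ 1/4)

/-- A set `Γ ⊆ ℓ²(ℕ)` is orthosymmetric if it is closed under coordinatewise sign flips. -/
def OrthosymmetricSeq (Γ : Set SeqL2) : Prop :=
  ∀ θ ∈ Γ, ∀ η : SeqL2, (∀ i, η i = θ i ∨ η i = -θ i) → η ∈ Γ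

/-- The coordinate-wise Kolmogorov dimension of `Γ ⊆ ℓ²(ℕ)` at scale `ε`. -/
noncomputable def kolDimCoord (Γ : Set SeqL2) (ε : ℝ) : ℕ :=
  sInf {d : ℕ | ∃ A : Finset ℕ, A.card = d ∧
    ∀ θ ∈ Γ, (∑' i : {i : ℕ // i ∉ A}, (θ (i : ℕ)) ^ 2) ≤ ε ^ 2}


section ProductDensity

/-- A product measure all but finitely many of whose factors are unchanged has the product of the
factor densities as its density. -/
lemma infinitePi_withDensity_prod {ι : Type*} {X : ι → Type*} [∀ i, MeasurableSpace (X i)]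
    (P : ∀ i, Measure (X i)) [∀ i, IsProbabilityMeasure (P i)]
    (f : ∀ i, X i → ℝ≥0∞) (hf : ∀ i, Measurable (f i))
    [∀ i, IsProbabilityMeasure ((P i).withDensity (f i))]
    (J : Finset ι) (hJ : ∀ i ∉ J, ∀ x, f i x = 1) :
    Measure.infinitePi (fun i => (P i).withDensity (f i)) =
      (Measure.infinitePi P).withDensity (fun x => ∏ i ∈ J, f i (x i)) := by
  classical
  symm
  refine Measure.eq_infinitePi _ fun s t ht => ?_
  have hmeas : MeasurableSet (Set.pi (s : Set ι) t) :=
    MeasurableSet.pi s.countable_toSet fun i _ => ht i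
  set t' : ∀ i, Set (X i) := fun i => if i ∈ s then t i else Set.univ with ht'
  have ht'm : ∀ i, MeasurableSet (t' i) := fun i => by
    simp only [ht']; split_ifs; exacts [ht i, MeasurableSet.univ]
  rw [withDensity_apply _ hmeas, ← lintegral_indicator hmeas]
  have hprod : ∀ x : ∀ i, X i,
      (Set.pi (s : Set ι) t).indicator (fun x => ∏ i ∈ J, f i (x i)) x =
        ∏ i ∈ s ∪ J, (t' i).indicator (f i) (x i) := by
    intro x
    by_cases hx : x ∈ Set.pi (s : Set ι) t
    · rw [Set.indicator_of_mem hx]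
      have hmem : ∀ i, x i ∈ t' i := fun i => by
        simp only [ht']; split_ifs with h
        exacts [hx i h, Set.mem_univ _]
      simp only [Set.indicator_of_mem (hmem _)]
      exact Finset.prod_subset Finset.subset_union_right fun i _ hi => hJ i hi _
    · rw [Set.indicator_of_notMem hx]
      simp only [Set.mem_pi, not_forall] at hx
      obtain ⟨i, hi, hxi⟩ := hx
      symm
      refine Finset.prod_eq_zero (Finset.mem_union_left _ hi) ?_
      refine Set.indicator_of_notMem ?_ _
      simpa [ht', Finset.mem_coe.1 hi] using hxi
  simp_rw [hprod]
  rw [lintegral_prod_eq_prod_lintegral_of_indepFun (s ∪ J)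
    (fun i (x : ∀ i, X i) => (t' i).indicator (f i) (x i))
    (iIndepFun_infinitePi fun i => (hf i).indicator (ht'm i))
    (fun i => ((hf i).indicator (ht'm i)).comp (measurable_pi_apply i))]
  have hfac : ∀ i, ∫⁻ x, (t' i).indicator (f i) (x i) ∂(Measure.infinitePi P) =
      (P i).withDensity (f i) (t' i) := by
    intro i
    rw [withDensity_apply _ (ht'm i), ← lintegral_indicator (ht'm i),
      ← Measure.infinitePi_map_eval P i,
      lintegral_map ((hf i).indicator (ht'm i)) (measurable_pi_apply i)]
  simp_rw [hfac]
  rw [← Finset.prod_subset (Finset.subset_union_left (s₂ := J))]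
  · exact Finset.prod_congr rfl fun i hi => by simp [ht', hi]
  · intro i _ hi
    simp only [ht', hi, if_false]
    exact measure_univ

lemma lintegral_pi_prod {ι E : Type*} [Fintype ι] [MeasurableSpace E] (ν : Measure E)
    [IsProbabilityMeasure ν] (g : ι → E → ℝ≥0∞) (hg : ∀ i, Measurable (g i)) :
    ∫⁻ x, ∏ i, g i (x i) ∂(Measure.pi fun _ : ι => ν) = ∏ i, ∫⁻ y, g i y ∂ν := by
  rw [lintegral_prod_eq_prod_lintegral_of_indepFun Finset.univ (fun i (x : ι → E) => g i (x i))
    (iIndepFun_pi fun i => (hg i).aemeasurable)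
    (fun i => (hg i).comp (measurable_pi_apply i))]
  refine Finset.prod_congr rfl fun i _ => ?_
  rw [(measurePreserving_eval (fun _ : ι => ν) i).lintegral_comp (hg i)]

lemma iidSamples_withDensity {E : Type*} [MeasurableSpace E] (n : ℕ) (ν : Measure E)
    [IsProbabilityMeasure ν] (f : E → ℝ≥0∞) (hf : Measurable f)
    [IsProbabilityMeasure (ν.withDensity f)] :
    iidSamples n (ν.withDensity f) =
      (iidSamples n ν).withDensity (fun x => ∏ j, f (x j)) := by
  refine Measure.pi_eq fun s hs => ?_
  have hmeas : MeasurableSet (Set.pi Set.univ s) := MeasurableSet.univ_pi hs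
  rw [withDensity_apply _ hmeas, ← lintegral_indicator hmeas]
  have hprod : ∀ x : Fin n → E,
      (Set.pi Set.univ s).indicator (fun x => ∏ j, f (x j)) x =
        ∏ j, (s j).indicator f (x j) := by
    intro x
    by_cases hx : x ∈ Set.pi Set.univ s
    · rw [Set.indicator_of_mem hx]
      exact Finset.prod_congr rfl fun j _ => (Set.indicator_of_mem (hx j trivial) _).symm
    · rw [Set.indicator_of_notMem hx]
      simp only [Set.mem_pi, not_forall] at hx
      obtain ⟨i, hi, hxi⟩ := hx
      exact (Finset.prod_eq_zero (Finset.mem_univ i) (Set.indicator_of_notMem hxi _)).symm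
  simp_rw [hprod]
  rw [iidSamples, lintegral_pi_prod ν _ fun j => hf.indicator (hs j)]
  refine Finset.prod_congr rfl fun j _ => ?_
  rw [withDensity_apply _ (hs j), lintegral_indicator (hs j)]

end ProductDensity

section GaussianSequence

lemma gaussianReal_eq_withDensity_exp (a : ℝ) :
    gaussianReal a 1 =
      (gaussianReal 0 1).withDensity (fun x => ENNReal.ofReal (Real.exp (a * x - a ^ 2 / 2))) := by
  rw [gaussianReal_of_var_ne_zero _ one_ne_zero, gaussianReal_of_var_ne_zero _ one_ne_zero,
    ← withDensity_mul _ (measurable_gaussianPDF _ _) (by fun_prop)]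
  congr 1
  ext x
  simp only [Pi.mul_apply, gaussianPDF, gaussianPDFReal]
  rw [← ENNReal.ofReal_mul (by positivity), mul_assoc _ (Real.exp _) (Real.exp _),
    ← Real.exp_add]
  congr 3
  simp only [NNReal.coe_one]
  ring

lemma IsGaussianSeq.eq_infinitePi {θ : ℕ → ℝ} {ν : Measure (ℕ → ℝ)} (h : IsGaussianSeq θ ν) :
    ν = Measure.infinitePi (fun i => gaussianReal (θ i) 1) :=
  h.2.unique (Measure.isProjectiveLimit_infinitePi fun i => gaussianReal (θ i) 1)

/-- The likelihood ratio of `n` samples of `N(θ, I)` against `N(0, I)`, for `θ` supported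
on `J`. -/
noncomputable def gaussLR (n : ℕ) (J : Finset ℕ) (θ : ℕ → ℝ) (x : Fin n → ℕ → ℝ) : ℝ :=
  ∏ j, ∏ i ∈ J, Real.exp (θ i * x j i - θ i ^ 2 / 2)

lemma gaussLR_nonneg (n : ℕ) (J : Finset ℕ) (θ : ℕ → ℝ) (x : Fin n → ℕ → ℝ) :
    0 ≤ gaussLR n J θ x :=
  Finset.prod_nonneg fun _ _ => Finset.prod_nonneg fun _ _ => (Real.exp_pos _).le

lemma measurable_gaussLR (n : ℕ) (J : Finset ℕ) (θ : ℕ → ℝ) : Measurable (gaussLR n J θ) := by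
  unfold gaussLR
  fun_prop

lemma iidSamples_gaussian_eq_withDensity {G : (ℕ → ℝ) → Measure (ℕ → ℝ)}
    (hG : ∀ θ : ℕ → ℝ, IsGaussianSeq θ (G θ)) (n : ℕ) (J : Finset ℕ) (θ : ℕ → ℝ)
    (hθ : ∀ i ∉ J, θ i = 0) :
    iidSamples n (G θ) =
      (iidSamples n (G 0)).withDensity (fun x => ENNReal.ofReal (gaussLR n J θ x)) := by
  have := (hG 0).1
  have := (hG θ).1
  set f : ℕ → ℝ → ℝ≥0∞ := fun i y => ENNReal.ofReal (Real.exp (θ i * y - θ i ^ 2 / 2)) with hf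
  have hfm : ∀ i, Measurable (f i) := fun i => by simp only [hf]; fun_prop
  have hd : G θ = (G 0).withDensity (fun x => ∏ i ∈ J, f i (x i)) := by
    have hprob : ∀ i, IsProbabilityMeasure ((gaussianReal 0 1).withDensity (f i)) := fun i => by
      rw [← gaussianReal_eq_withDensity_exp]; infer_instance
    rw [(hG θ).eq_infinitePi, (hG 0).eq_infinitePi]
    simp only [Pi.zero_apply]
    rw [← infinitePi_withDensity_prod (fun _ => gaussianReal 0 1) f hfm J]
    · simp only [hf, ← gaussianReal_eq_withDensity_exp]
    · intro i hi y
      simp [hf, hθ i hi]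
  have : IsProbabilityMeasure ((G 0).withDensity (fun x => ∏ i ∈ J, f i (x i))) := by
    rw [← hd]; infer_instance
  have hprodm : Measurable fun x : ℕ → ℝ => ∏ i ∈ J, f i (x i) :=
    Finset.measurable_prod _ fun i _ => (hfm i).comp (measurable_pi_apply i)
  rw [hd, iidSamples_withDensity n (G 0) _ hprodm]
  congr 1
  ext x
  rw [gaussLR, ENNReal.ofReal_prod_of_nonneg fun _ _ => by positivity]
  refine Finset.prod_congr rfl fun j _ => ?_
  rw [ENNReal.ofReal_prod_of_nonneg fun _ _ => by positivity]

lemma isProbabilityMeasure_iidSamples {E : Type*} [MeasurableSpace E] (n : ℕ) (ν : Measure E)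
    [IsProbabilityMeasure ν] : IsProbabilityMeasure (iidSamples n ν) := by
  unfold iidSamples; infer_instance

/-- The `i`-th coordinate of the sample mean. -/
noncomputable def sampleMean (n : ℕ) (x : Fin n → ℕ → ℝ) (i : ℕ) : ℝ := (∑ j, x j i) / n

lemma measurable_sampleMean (n i : ℕ) : Measurable fun x => sampleMean n x i := by
  unfold sampleMean
  fun_prop

lemma lintegral_exp_gaussianReal (μ t : ℝ) :
    ∫⁻ y, ENNReal.ofReal (Real.exp (t * (y - μ))) ∂(gaussianReal μ 1) =
      ENNReal.ofReal (Real.exp (t ^ 2 / 2)) := by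
  have h : ∀ y : ℝ, Real.exp (t * (y - μ)) = Real.exp (-(t * μ)) * Real.exp (t * y) := fun y => by
    rw [← Real.exp_add]; ring_nf
  simp_rw [h]
  rw [← ofReal_integral_eq_lintegral_ofReal
    ((integrable_exp_mul_gaussianReal t).const_mul _) (Filter.Eventually.of_forall fun y => by positivity),
    integral_const_mul]
  have := congrFun (mgf_id_gaussianReal (μ := μ) (v := 1)) t
  simp only [mgf, id] at this
  rw [this, ← Real.exp_add]
  congr 2
  simp only [NNReal.coe_one]
  ring

/-- The moment generating function of the centred sample mean. -/
lemma lintegral_exp_sampleMean {G : (ℕ → ℝ) → Measure (ℕ → ℝ)}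
    (hG : ∀ θ : ℕ → ℝ, IsGaussianSeq θ (G θ)) {n : ℕ} (hn : 0 < n) (θ : ℕ → ℝ) (i : ℕ) (a : ℝ) :
    ∫⁻ x, ENNReal.ofReal (Real.exp (a * (sampleMean n x i - θ i))) ∂(iidSamples n (G θ)) =
      ENNReal.ofReal (Real.exp (a ^ 2 / (2 * n))) := by
  have := (hG θ).1
  have hn' : (n : ℝ) ≠ 0 := by positivity
  have h : ∀ x : Fin n → ℕ → ℝ, ENNReal.ofReal (Real.exp (a * (sampleMean n x i - θ i))) =
      ∏ j, ENNReal.ofReal (Real.exp (a / n * (x j i - θ i))) := fun x => by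
    rw [← ENNReal.ofReal_prod_of_nonneg fun _ _ => by positivity, ← Real.exp_sum,
      ← Finset.mul_sum, Finset.sum_sub_distrib]
    congr 2
    simp only [sampleMean, Finset.sum_const, Finset.card_univ, Fintype.card_fin, nsmul_eq_mul]
    field_simp
  simp_rw [h]
  rw [iidSamples, lintegral_pi_prod (G θ)
    (fun _ y => ENNReal.ofReal (Real.exp (a / n * (y i - θ i)))) (fun _ => by fun_prop)]
  have h1 : ∫⁻ y, ENNReal.ofReal (Real.exp (a / n * (y i - θ i))) ∂(G θ) =
      ENNReal.ofReal (Real.exp ((a / n) ^ 2 / 2)) := by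
    rw [← lintegral_exp_gaussianReal (θ i) (a / n), (hG θ).eq_infinitePi,
      ← Measure.infinitePi_map_eval (fun i => gaussianReal (θ i) 1) i,
      lintegral_map (by fun_prop) (measurable_pi_apply i)]
  simp only [h1, Finset.prod_const, Finset.card_univ, Fintype.card_fin]
  rw [← ENNReal.ofReal_pow (by positivity), ← Real.exp_nat_mul]
  congr 2
  field_simp

end GaussianSequence

section TestingLowerBound

/-- The vector that agrees with `η` on `t` and with `-η` off `t`. -/
noncomputable def signVec (η : ℕ → ℝ) (t : Finset ℕ) (i : ℕ) : ℝ := if i ∈ t then η i else -η i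

lemma signVec_eq_or (η : ℕ → ℝ) (t : Finset ℕ) (i : ℕ) :
    signVec η t i = η i ∨ signVec η t i = -η i := by
  unfold signVec; split_ifs <;> simp

lemma gaussLR_mul (n : ℕ) (J : Finset ℕ) (u v : ℕ → ℝ) (x : Fin n → ℕ → ℝ) :
    gaussLR n J u x * gaussLR n J v x =
      Real.exp (n * ∑ i ∈ J, u i * v i) * gaussLR n J (u + v) x := by
  simp only [gaussLR, ← Real.exp_sum, ← Real.exp_add, Pi.add_apply]
  congr 1
  have h : (n : ℝ) * ∑ i ∈ J, u i * v i = ∑ _j : Fin n, ∑ i ∈ J, u i * v i := by simp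
  rw [h, ← Finset.sum_add_distrib, ← Finset.sum_add_distrib]
  refine Finset.sum_congr rfl fun j _ => ?_
  rw [← Finset.sum_add_distrib, ← Finset.sum_add_distrib]
  exact Finset.sum_congr rfl fun i _ => by ring

lemma lintegral_gaussLR {G : (ℕ → ℝ) → Measure (ℕ → ℝ)}
    (hG : ∀ θ : ℕ → ℝ, IsGaussianSeq θ (G θ)) (n : ℕ) (J : Finset ℕ) (θ : ℕ → ℝ)
    (hθ : ∀ i ∉ J, θ i = 0) :
    ∫⁻ x, ENNReal.ofReal (gaussLR n J θ x) ∂(iidSamples n (G 0)) = 1 := by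
  have := (hG θ).1
  have := isProbabilityMeasure_iidSamples n (G θ)
  rw [← setLIntegral_univ, ← withDensity_apply _ MeasurableSet.univ,
    ← iidSamples_gaussian_eq_withDensity hG n J θ hθ, measure_univ]

lemma integrable_gaussLR {G : (ℕ → ℝ) → Measure (ℕ → ℝ)}
    (hG : ∀ θ : ℕ → ℝ, IsGaussianSeq θ (G θ)) (n : ℕ) (J : Finset ℕ) (θ : ℕ → ℝ)
    (hθ : ∀ i ∉ J, θ i = 0) : Integrable (gaussLR n J θ) (iidSamples n (G 0)) := by
  refine (lintegral_ofReal_ne_top_iff_integrable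
    (measurable_gaussLR n J θ).aestronglyMeasurable
    (Filter.Eventually.of_forall fun x => gaussLR_nonneg n J θ x)).1 ?_
  rw [lintegral_gaussLR hG n J θ hθ]
  exact ENNReal.one_ne_top

lemma integral_gaussLR {G : (ℕ → ℝ) → Measure (ℕ → ℝ)}
    (hG : ∀ θ : ℕ → ℝ, IsGaussianSeq θ (G θ)) (n : ℕ) (J : Finset ℕ) (θ : ℕ → ℝ)
    (hθ : ∀ i ∉ J, θ i = 0) : ∫ x, gaussLR n J θ x ∂(iidSamples n (G 0)) = 1 := by
  rw [integral_eq_lintegral_of_nonneg_ae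
    (Filter.Eventually.of_forall fun x => gaussLR_nonneg n J θ x)
    (measurable_gaussLR n J θ).aestronglyMeasurable, lintegral_gaussLR hG n J θ hθ]
  simp

lemma sum_exp_signVec_le (n : ℕ) (J : Finset ℕ) (η : ℕ → ℝ) (t : Finset ℕ) :
    ∑ t' ∈ J.powerset, Real.exp (n * ∑ i ∈ J, signVec η t i * signVec η t' i) ≤
      2 ^ J.card * Real.exp ((n : ℝ) ^ 2 * (∑ i ∈ J, η i ^ 4) / 2) := by
  have h1 : ∀ t' ∈ J.powerset, Real.exp (n * ∑ i ∈ J, signVec η t i * signVec η t' i) =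
      (∏ i ∈ t', Real.exp (n * (signVec η t i * η i))) *
        ∏ i ∈ J \ t', Real.exp (-(n * (signVec η t i * η i))) := by
    intro t' ht'
    rw [← Real.exp_sum, ← Real.exp_sum, ← Real.exp_add, Finset.mul_sum,
      ← Finset.sum_sdiff (Finset.mem_powerset.1 ht'), add_comm]
    congr 2
    · exact Finset.sum_congr rfl fun i hi => by simp [signVec, hi]
    · refine Finset.sum_congr rfl fun i hi => ?_
      rw [signVec.eq_1 η t', if_neg (Finset.mem_sdiff.1 hi).2]
      ring
  rw [Finset.sum_congr rfl h1, ← Finset.prod_add]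
  calc ∏ i ∈ J, (Real.exp (n * (signVec η t i * η i)) + Real.exp (-(n * (signVec η t i * η i))))
      ≤ ∏ i ∈ J, 2 * Real.exp ((n : ℝ) ^ 2 * η i ^ 4 / 2) := by
        refine Finset.prod_le_prod (fun i _ => by positivity) fun i _ => ?_
        have h2 := Real.cosh_le_exp_half_sq (n * (signVec η t i * η i))
        rw [Real.cosh_eq] at h2
        have h3 : (n * (signVec η t i * η i)) ^ 2 / 2 = (n : ℝ) ^ 2 * η i ^ 4 / 2 := by
          rcases signVec_eq_or η t i with h | h <;> rw [h] <;> ring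
        rw [h3] at h2
        linarith
    _ = _ := by
        rw [Finset.prod_mul_distrib, Finset.prod_const, ← Real.exp_sum, Finset.mul_sum,
          Finset.sum_div]

/-- Second-moment bound: if a test with both errors at most `1/4` separates `0` from every sign
change of a finitely supported `η`, then the number of samples is bounded below in terms of the
`ℓ⁴` norm of `η`. -/
lemma one_lt_sq_mul_sum_pow_four {G : (ℕ → ℝ) → Measure (ℕ → ℝ)}
    (hG : ∀ θ : ℕ → ℝ, IsGaussianSeq θ (G θ)) (n : ℕ) (J : Finset ℕ) (η : ℕ → ℝ)
    (hη : ∀ i ∉ J, η i = 0) (ψ : (Fin n → (ℕ → ℝ)) → Bool) (hψ : Measurable ψ)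
    (h0 : (iidSamples n (G 0)) {x | ψ x = true} ≤ 1 / 4)
    (h1 : ∀ t ∈ J.powerset, (iidSamples n (G (signVec η t))) {x | ψ x = false} ≤ 1 / 4) :
    1 < (n : ℝ) ^ 2 * ∑ i ∈ J, η i ^ 4 := by
  by_contra hcon
  push Not at hcon
  have := (hG 0).1
  set μ := iidSamples n (G 0) with hμ
  have hμp : IsProbabilityMeasure μ := isProbabilityMeasure_iidSamples n (G 0)
  set S : Set (Fin n → ℕ → ℝ) := {x | ψ x = true} with hS
  have hSm : MeasurableSet S := hψ (measurableSet_singleton true)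
  have hsupp : ∀ t, ∀ i ∉ J, signVec η t i = 0 := fun t i hi => by
    rcases signVec_eq_or η t i with h | h <;> rw [h, hη i hi]; simp
  have hsupp2 : ∀ t t', ∀ i ∉ J, (signVec η t + signVec η t') i = 0 := fun t t' i hi => by
    rw [Pi.add_apply, hsupp t i hi, hsupp t' i hi, add_zero]
  set R : Finset ℕ → (Fin n → ℕ → ℝ) → ℝ := fun t => gaussLR n J (signVec η t) with hR
  have hRi : ∀ t, Integrable (R t) μ := fun t => integrable_gaussLR hG n J _ (hsupp t)
  have hmul : ∀ t t' x, R t x * R t' x =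
      Real.exp (n * ∑ i ∈ J, signVec η t i * signVec η t' i) *
        gaussLR n J (signVec η t + signVec η t') x := fun t t' x => gaussLR_mul n J _ _ x
  have hRRi : ∀ t t', Integrable (fun x => R t x * R t' x) μ := fun t t' => by
    simp only [hmul]
    exact (integrable_gaussLR hG n J _ (hsupp2 t t')).const_mul _
  have hRR : ∀ t t', ∫ x, R t x * R t' x ∂μ =
      Real.exp (n * ∑ i ∈ J, signVec η t i * signVec η t' i) := fun t t' => by
    simp only [hmul]
    rw [integral_const_mul, integral_gaussLR hG n J _ (hsupp2 t t'), mul_one]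
  have hpow : ∀ t ∈ J.powerset, 3 / 4 ≤ ∫ x in S, R t x ∂μ := by
    intro t ht
    have := (hG (signVec η t)).1
    have hp := isProbabilityMeasure_iidSamples n (G (signVec η t))
    have hc : Sᶜ = {x | ψ x = false} := by ext x; simp [hS]
    have hle := h1 t ht
    rw [← hc, prob_compl_eq_one_sub hSm] at hle
    have hge : 3 / 4 ≤ (iidSamples n (G (signVec η t))) S := by
      have h34 : (1 : ℝ≥0∞) ≤ 1 / 4 + (iidSamples n (G (signVec η t))) S :=
        tsub_le_iff_right.1 hle
      have h1' : (1 : ℝ≥0∞) = 1 / 4 + 3 / 4 := by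
        rw [ENNReal.div_add_div_same]
        norm_num
        exact (ENNReal.div_self (by norm_num) (by norm_num)).symm
      have hfin : (1 / 4 : ℝ≥0∞) ≠ ∞ := by simp
      exact (ENNReal.add_le_add_iff_left hfin).1 (h1'.symm.le.trans h34)
    rw [iidSamples_gaussian_eq_withDensity hG n J _ (hsupp t), withDensity_apply _ hSm,
      ← ofReal_integral_eq_lintegral_ofReal (hRi t).integrableOn
        (Filter.Eventually.of_forall fun x => gaussLR_nonneg n J _ x)] at hge
    have hq : (3 / 4 : ℝ≥0∞) = ENNReal.ofReal (3 / 4) := by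
      rw [ENNReal.ofReal_div_of_pos (by norm_num)]; simp
    rw [hq] at hge
    exact (ENNReal.ofReal_le_ofReal_iff
      (integral_nonneg fun x => gaussLR_nonneg n J _ x)).1 hge
  set K : ℝ := 2 ^ J.card with hK
  have hKpos : 0 < K := by positivity
  have hcard : (J.powerset.card : ℝ) = K := by simp [hK]
  set F : (Fin n → ℕ → ℝ) → ℝ := fun x => ∑ t ∈ J.powerset, R t x with hF
  have hFi : Integrable F μ := integrable_finsetSum _ fun t _ => hRi t
  have hF2 : ∀ x, F x ^ 2 = ∑ t ∈ J.powerset, ∑ t' ∈ J.powerset, R t x * R t' x := fun x => by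
    rw [sq, Finset.sum_mul_sum]
  have hF2i : Integrable (fun x => F x ^ 2) μ := by
    simp only [hF2]
    exact integrable_finsetSum _ fun t _ => integrable_finsetSum _ fun t' _ => hRRi t t'
  have hlow : 3 / 4 * K ≤ ∫ x in S, F x ∂μ := by
    rw [integral_finsetSum _ fun t _ => (hRi t).integrableOn]
    calc 3 / 4 * K = ∑ _t ∈ J.powerset, (3 / 4 : ℝ) := by
          rw [Finset.sum_const, nsmul_eq_mul, hcard, mul_comm]
      _ ≤ _ := Finset.sum_le_sum hpow
  have hsecond : ∫ x, F x ^ 2 ∂μ ≤ 2 * K ^ 2 := by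
    simp only [hF2]
    rw [integral_finsetSum _ fun t _ => integrable_finsetSum _ fun t' _ => hRRi t t']
    simp only [integral_finsetSum _ fun t' _ => hRRi _ t', hRR]
    have hexp : Real.exp ((n : ℝ) ^ 2 * (∑ i ∈ J, η i ^ 4) / 2) ≤ 2 := by
      calc Real.exp ((n : ℝ) ^ 2 * (∑ i ∈ J, η i ^ 4) / 2) ≤ Real.exp (1 / 2) := by
            apply Real.exp_le_exp.2; linarith
        _ ≤ 2 := by
            have h4 : Real.exp (1 / 2) ^ 2 = Real.exp 1 := by
              rw [← Real.exp_nat_mul]; norm_num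
            have := Real.exp_one_lt_d9
            nlinarith [Real.exp_pos (1 / 2)]
    calc _ ≤ ∑ _t ∈ J.powerset, K * 2 := by
          refine Finset.sum_le_sum fun t _ => (sum_exp_signVec_le n J η t).trans ?_
          exact mul_le_mul_of_nonneg_left hexp hKpos.le
      _ = 2 * K ^ 2 := by
          rw [Finset.sum_const, nsmul_eq_mul, hcard]; ring
  have hμS : μ.real S ≤ 1 / 4 := by
    have := ENNReal.toReal_mono (by simp) h0
    simpa [Measure.real] using this
  have hup : ∫ x in S, F x ∂μ ≤ 1 / (5 * K) * (2 * K ^ 2) + 5 / 4 * K * (1 / 4) := by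
    calc ∫ x in S, F x ∂μ ≤ ∫ x in S, (1 / (5 * K) * F x ^ 2 + 5 / 4 * K) ∂μ := by
          refine integral_mono hFi.integrableOn
            ((hF2i.integrableOn.const_mul _).add (integrable_const _)) fun x => ?_
          have h5 : 1 / (5 * K) * F x ^ 2 + 5 / 4 * K - F x =
              1 / (5 * K) * (F x - 5 / 2 * K) ^ 2 := by
            field_simp; ring
          have : 0 ≤ 1 / (5 * K) * (F x - 5 / 2 * K) ^ 2 := by positivity
          simp only
          linarith
      _ = 1 / (5 * K) * ∫ x in S, F x ^ 2 ∂μ + 5 / 4 * K * μ.real S := by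
          rw [integral_add (hF2i.integrableOn.const_mul _) (integrable_const _),
            integral_const_mul, setIntegral_const, smul_eq_mul, mul_comm (μ.real S)]
      _ ≤ _ := by
          have h6 : ∫ x in S, F x ^ 2 ∂μ ≤ ∫ x, F x ^ 2 ∂μ :=
            setIntegral_le_integral hF2i (Filter.Eventually.of_forall fun x => sq_nonneg _)
          gcongr
          exact h6.trans hsecond
  have h7 : 1 / (5 * K) * (2 * K ^ 2) = 2 / 5 * K := by field_simp
  rw [h7] at hup
  linarith

end TestingLowerBound

section OrthosymmetricSets

lemma SeqL2.hasSum_sq (θ : SeqL2) : HasSum (fun i => θ i ^ 2) (‖θ‖ ^ 2) := by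
  have h := lp.hasSum_norm (p := 2) (by norm_num) θ
  simpa using h

/-- The finitely supported vector of `ℓ²` with entries `f` on `A`. -/
noncomputable def SeqL2.ofFinset (A : Finset ℕ) (f : ℕ → ℝ) : SeqL2 :=
  ∑ i ∈ A, lp.single 2 i (f i)

lemma SeqL2.ofFinset_apply (A : Finset ℕ) (f : ℕ → ℝ) (i : ℕ) :
    SeqL2.ofFinset A f i = if i ∈ A then f i else 0 := by
  simp only [SeqL2.ofFinset, lp.coeFn_sum, Finset.sum_apply, lp.coeFn_single, Finset.sum_pi_single]

lemma SeqL2.norm_sq_eq_sum {A : Finset ℕ} {v : SeqL2} (hv : ∀ i ∉ A, v i = 0) :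
    ‖v‖ ^ 2 = ∑ i ∈ A, v i ^ 2 :=
  (SeqL2.hasSum_sq v).unique (hasSum_sum_of_ne_finset_zero fun i hi => by simp [hv i hi])

variable {Γ : Set SeqL2}

lemma OrthosymmetricSeq.mem_of_abs_le_of_eq_off_singleton (horth : OrthosymmetricSeq Γ)
    (hconv : Convex ℝ Γ) {θ v : SeqL2} (hθ : θ ∈ Γ) (a : ℕ) (ha : |v a| ≤ |θ a|)
    (hne : ∀ i, i ≠ a → v i = θ i) : v ∈ Γ := by
  by_cases h0 : θ a = 0
  · have : v = θ := by
      ext i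
      by_cases hi : i = a
      · subst hi
        rw [h0, abs_zero, abs_nonpos_iff] at ha
        rw [ha, h0]
      · exact hne i hi
    rwa [this]
  · set w : SeqL2 := θ - lp.single 2 a (2 * θ a) with hw
    have hwa : w a = -θ a := by
      simp only [hw, lp.coeFn_sub, Pi.sub_apply, lp.single_apply_self]; ring
    have hwi : ∀ i, i ≠ a → w i = θ i := fun i hi => by
      simp only [hw, lp.coeFn_sub, Pi.sub_apply, lp.single_apply_ne 2 a _ hi, sub_zero]
    have hwΓ : w ∈ Γ := horth θ hθ w fun i => by
      by_cases hi : i = a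
      · subst hi; exact Or.inr hwa
      · exact Or.inl (hwi i hi)
    have hq : |v a / θ a| ≤ 1 := by
      rw [abs_div]; exact div_le_one_of_le₀ ha (abs_nonneg _)
    obtain ⟨hq1, hq2⟩ := abs_le.1 hq
    have hv : v = ((1 + v a / θ a) / 2) • θ + ((1 - v a / θ a) / 2) • w := by
      ext i
      simp only [lp.coeFn_add, lp.coeFn_smul, Pi.add_apply, Pi.smul_apply, smul_eq_mul]
      by_cases hi : i = a
      · subst hi
        rw [hwa]; field_simp; ring
      · rw [hwi i hi, hne i hi]; ring
    rw [hv]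
    exact hconv hθ hwΓ (by linarith) (by linarith) (by ring)

lemma OrthosymmetricSeq.mem_of_abs_le_of_eq_off (horth : OrthosymmetricSeq Γ)
    (hconv : Convex ℝ Γ) {θ : SeqL2} (hθ : θ ∈ Γ) (A : Finset ℕ) :
    ∀ v : SeqL2, (∀ i ∈ A, |v i| ≤ |θ i|) → (∀ i ∉ A, v i = θ i) → v ∈ Γ := by
  induction A using Finset.induction_on with
  | empty =>
    intro v _ h
    have : v = θ := by ext i; exact h i (Finset.notMem_empty i)
    rwa [this]
  | insert a A ha ih =>
    intro v h1 h2
    set w : SeqL2 := v + lp.single 2 a (θ a - v a) with hw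
    have hwa : w a = θ a := by
      simp only [hw, lp.coeFn_add, Pi.add_apply, lp.single_apply_self]; ring
    have hwi : ∀ i, i ≠ a → w i = v i := fun i hi => by
      simp only [hw, lp.coeFn_add, Pi.add_apply, lp.single_apply_ne 2 a _ hi, add_zero]
    have hwΓ : w ∈ Γ := by
      refine ih w (fun i hi => ?_) (fun i hi => ?_)
      · rw [hwi i (fun h => ha (h ▸ hi))]
        exact h1 i (Finset.mem_insert_of_mem hi)
      · by_cases hia : i = a
        · rw [hia, hwa]
        · rw [hwi i hia]
          exact h2 i (by simp [hia, hi])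
    refine horth.mem_of_abs_le_of_eq_off_singleton hconv hwΓ a ?_ fun i hi => (hwi i hi).symm
    rw [hwa]
    exact h1 a (Finset.mem_insert_self a A)

/-- A convex orthosymmetric set is solid with respect to finitely supported vectors. -/
lemma OrthosymmetricSeq.mem_of_abs_le (horth : OrthosymmetricSeq Γ)
    (hconv : Convex ℝ Γ) {θ v : SeqL2} (hθ : θ ∈ Γ) (A : Finset ℕ)
    (h1 : ∀ i ∈ A, |v i| ≤ |θ i|) (h2 : ∀ i ∉ A, v i = 0) : v ∈ Γ := by
  set u : SeqL2 := SeqL2.ofFinset A θ with hu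
  have hua : ∀ i, u i = if i ∈ A then θ i else 0 := SeqL2.ofFinset_apply A θ
  have huΓ : u ∈ Γ := by
    have hw : (2 : ℝ) • u - θ ∈ Γ := horth θ hθ _ fun i => by
      simp only [lp.coeFn_sub, lp.coeFn_smul, Pi.sub_apply, Pi.smul_apply, smul_eq_mul, hua]
      split_ifs
      · left; ring
      · right; ring
    have hmid : u = (1 / 2 : ℝ) • θ + (1 / 2 : ℝ) • ((2 : ℝ) • u - θ) := by
      ext i
      simp only [lp.coeFn_add, lp.coeFn_sub, lp.coeFn_smul, Pi.add_apply, Pi.sub_apply,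
        Pi.smul_apply, smul_eq_mul]
      ring
    rw [hmid]
    exact hconv hθ hw (by norm_num) (by norm_num) (by norm_num)
  refine horth.mem_of_abs_le_of_eq_off hconv huΓ A v (fun i hi => ?_) (fun i hi => ?_)
  · simpa [hua, hi] using h1 i hi
  · simpa [hua, hi] using h2 i hi

/-- Compact subsets of `ℓ²` have uniformly small tails. -/
lemma exists_finset_norm_sq_lt (hcomp : IsCompact Γ) {δ : ℝ} (hδ : 0 < δ) :
    ∃ A : Finset ℕ, ∀ θ ∈ Γ, ‖θ‖ ^ 2 < ∑ i ∈ A, θ i ^ 2 + δ := by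
  refine hcomp.elim_directed_cover
    (fun A : Finset ℕ => {θ : SeqL2 | ‖θ‖ ^ 2 < ∑ i ∈ A, θ i ^ 2 + δ}) (fun A => ?_) ?_ ?_
  · have hc : ∀ i, Continuous fun θ : SeqL2 => θ i := fun i =>
      (lp.lipschitzWith_one_eval (E := fun _ : ℕ => ℝ) 2 i).continuous
    exact isOpen_lt (by fun_prop)
      ((continuous_finsetSum _ fun i _ => (hc i).pow 2).add continuous_const)
  · intro θ _
    have h := (SeqL2.hasSum_sq θ).eventually (lt_mem_nhds (show ‖θ‖ ^ 2 - δ < ‖θ‖ ^ 2 by linarith))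
    obtain ⟨A, hA⟩ := h.exists
    refine Set.mem_iUnion.2 ⟨A, ?_⟩
    simp only [Set.mem_ofPred_eq]
    linarith
  · refine directed_of_isDirected_le fun A B hAB θ hθ => ?_
    simp only [Set.mem_ofPred_eq] at hθ ⊢
    have := Finset.sum_le_sum_of_subset_of_nonneg (f := fun i => θ i ^ 2) hAB
      fun i _ _ => sq_nonneg _
    linarith

end OrthosymmetricSets

section Estimation

/-- Soft thresholding at level `t`. -/
noncomputable def softThresh (t y : ℝ) : ℝ := y - max (-t) (min t y)

lemma measurable_softThresh (t : ℝ) : Measurable (softThresh t) := by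
  unfold softThresh
  fun_prop

lemma softThresh_zero (y : ℝ) : softThresh 0 y = y := by
  simp [softThresh]

lemma softThresh_sub_sq_le_large {t : ℝ} (ht : 0 ≤ t) (y θ : ℝ) :
    (softThresh t y - θ) ^ 2 ≤ 2 * (y - θ) ^ 2 + 2 * t ^ 2 := by
  have h1 : -t ≤ max (-t) (min t y) := le_max_left _ _
  have h2 : max (-t) (min t y) ≤ t := max_le (by linarith) (min_le_left _ _)
  unfold softThresh
  set c := max (-t) (min t y)
  have hc : c ^ 2 ≤ t ^ 2 := sq_le_sq' h1 h2
  nlinarith [sq_nonneg (y - θ + c)]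

lemma softThresh_sub_sq_le_small {t : ℝ} (ht : 0 ≤ t) (y θ : ℝ) :
    (softThresh t y - θ) ^ 2 ≤ 2 * θ ^ 2 + 2 * softThresh t (y - θ) ^ 2 := by
  have key : ∀ u w : ℝ, u ≤ w → softThresh t u ≤ softThresh t w ∧
      softThresh t w ≤ softThresh t u + (w - u) := by
    intro u w huw
    unfold softThresh
    constructor <;>
    · rcases le_total t u with h1 | h1 <;> rcases le_total t w with h2 | h2 <;>
      rcases le_total (-t) u with h3 | h3 <;> rcases le_total (-t) w with h4 | h4 <;>
      simp [*] <;> linarith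
  set a := softThresh t y
  set b := softThresh t (y - θ)
  have habs : |a - θ| ≤ |b| + |θ| := by
    rcases le_total 0 θ with h | h
    · obtain ⟨h1, h2⟩ : b ≤ a ∧ a ≤ b + (y - (y - θ)) := key (y - θ) y (by linarith)
      rw [abs_of_nonneg h]
      exact abs_le.2 ⟨by linarith [neg_abs_le b], by linarith [le_abs_self b]⟩
    · obtain ⟨h1, h2⟩ : a ≤ b ∧ b ≤ a + (y - θ - y) := key y (y - θ) (by linarith)
      rw [abs_of_nonpos h]
      exact abs_le.2 ⟨by linarith [neg_abs_le b], by linarith [le_abs_self b]⟩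
  rw [← sq_abs (a - θ), ← sq_abs θ, ← sq_abs b]
  nlinarith [abs_nonneg (a - θ), sq_nonneg (|b| - |θ|)]

lemma softThresh_sq_le_exp {t : ℝ} (ht : 0 ≤ t) {a : ℝ} (ha : 0 < a) (z : ℝ) :
    softThresh t z ^ 2 ≤
      2 / a ^ 2 * Real.exp (-(a * t)) * (Real.exp (a * z) + Real.exp (-a * z)) := by
  have hsq : ∀ u : ℝ, 0 ≤ u → u ^ 2 ≤ 2 / a ^ 2 * Real.exp (a * u) := fun u hu => by
    have h := Real.quadratic_le_exp_of_nonneg (mul_nonneg ha.le hu)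
    rw [div_mul_eq_mul_div, le_div_iff₀ (by positivity)]
    nlinarith [mul_nonneg ha.le hu]
  rcases le_total z t with h1 | h1
  · rcases le_total (-t) z with h2 | h2
    · have : softThresh t z = 0 := by simp [softThresh, h1, h2]
      rw [this, zero_pow two_ne_zero]; positivity
    · have : softThresh t z = z + t := by simp [softThresh, h1, h2]
      rw [this]
      calc (z + t) ^ 2 = (-z - t) ^ 2 := by ring
        _ ≤ 2 / a ^ 2 * Real.exp (a * (-z - t)) := hsq _ (by linarith)
        _ = 2 / a ^ 2 * Real.exp (-(a * t)) * Real.exp (-a * z) := by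
          rw [mul_assoc, ← Real.exp_add]; ring_nf
        _ ≤ _ := by
          have := Real.exp_pos (a * z)
          gcongr; linarith
  · have : softThresh t z = z - t := by
      have : -t ≤ t := by linarith
      simp [softThresh, h1, this]
    rw [this]
    calc (z - t) ^ 2 ≤ 2 / a ^ 2 * Real.exp (a * (z - t)) := hsq _ (by linarith)
      _ = 2 / a ^ 2 * Real.exp (-(a * t)) * Real.exp (a * z) := by
        rw [mul_assoc, ← Real.exp_add]; ring_nf
      _ ≤ _ := by
        have := Real.exp_pos (-a * z)
        gcongr; linarith

variable {G : (ℕ → ℝ) → Measure (ℕ → ℝ)}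

lemma lintegral_softThresh_noise_le (hG : ∀ θ : ℕ → ℝ, IsGaussianSeq θ (G θ)) {m : ℕ}
    (hm : 0 < m) (θ : ℕ → ℝ) (i : ℕ) {t a : ℝ} (ht : 0 ≤ t) (ha : 0 < a) :
    ∫⁻ x, ENNReal.ofReal (softThresh t (sampleMean m x i - θ i) ^ 2) ∂(iidSamples m (G θ)) ≤
      ENNReal.ofReal (4 / a ^ 2 * Real.exp (a ^ 2 / (2 * m) - a * t)) := by
  have hmeas := measurable_sampleMean m i
  have hC : 0 ≤ 2 / a ^ 2 * Real.exp (-(a * t)) := by positivity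
  calc ∫⁻ x, ENNReal.ofReal (softThresh t (sampleMean m x i - θ i) ^ 2) ∂(iidSamples m (G θ))
      ≤ ∫⁻ x, ENNReal.ofReal (2 / a ^ 2 * Real.exp (-(a * t))) *
          (ENNReal.ofReal (Real.exp (a * (sampleMean m x i - θ i))) +
            ENNReal.ofReal (Real.exp (-a * (sampleMean m x i - θ i)))) ∂(iidSamples m (G θ)) := by
        refine lintegral_mono fun x => ?_
        rw [← ENNReal.ofReal_add (by positivity) (by positivity), ← ENNReal.ofReal_mul hC]
        exact ENNReal.ofReal_le_ofReal (softThresh_sq_le_exp ht ha _)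
    _ = ENNReal.ofReal (4 / a ^ 2 * Real.exp (a ^ 2 / (2 * m) - a * t)) := by
        rw [lintegral_const_mul _ (by fun_prop), lintegral_add_left (by fun_prop),
          lintegral_exp_sampleMean hG hm, lintegral_exp_sampleMean hG hm,
          ← ENNReal.ofReal_add (by positivity) (by positivity), ← ENNReal.ofReal_mul hC]
        congr 1
        rw [neg_sq, sub_eq_add_neg, Real.exp_add]
        ring

lemma lintegral_sampleMean_sub_sq_le (hG : ∀ θ : ℕ → ℝ, IsGaussianSeq θ (G θ)) {m : ℕ}
    (hm : 0 < m) (θ : ℕ → ℝ) (i : ℕ) :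
    ∫⁻ x, ENNReal.ofReal ((sampleMean m x i - θ i) ^ 2) ∂(iidSamples m (G θ)) ≤
      ENNReal.ofReal (6 / m) := by
  have hm' : (0 : ℝ) < m := by positivity
  have ha : 0 < √(2 * m) := by positivity
  have h := lintegral_softThresh_noise_le hG hm θ i le_rfl ha
  simp only [softThresh_zero] at h
  refine h.trans (ENNReal.ofReal_le_ofReal ?_)
  rw [Real.sq_sqrt (by positivity), mul_zero, sub_zero, div_self (by positivity)]
  have := Real.exp_one_lt_d9
  rw [div_mul_eq_mul_div, div_le_div_iff₀ (by positivity) hm']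
  nlinarith

lemma lintegral_softThresh_le_large (hG : ∀ θ : ℕ → ℝ, IsGaussianSeq θ (G θ)) {m : ℕ}
    (hm : 0 < m) (θ : ℕ → ℝ) (i : ℕ) {t : ℝ} (ht : 0 ≤ t) :
    ∫⁻ x, ENNReal.ofReal ((softThresh t (sampleMean m x i) - θ i) ^ 2) ∂(iidSamples m (G θ)) ≤
      ENNReal.ofReal (12 / m + 2 * t ^ 2) := by
  have := (hG θ).1
  have := isProbabilityMeasure_iidSamples m (G θ)
  have hmeas := measurable_sampleMean m i
  calc _ ≤ ∫⁻ x, (ENNReal.ofReal 2 * ENNReal.ofReal ((sampleMean m x i - θ i) ^ 2) +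
          ENNReal.ofReal (2 * t ^ 2)) ∂(iidSamples m (G θ)) := by
        refine lintegral_mono fun x => ?_
        rw [← ENNReal.ofReal_mul (by norm_num), ← ENNReal.ofReal_add (by positivity) (by positivity)]
        exact ENNReal.ofReal_le_ofReal (softThresh_sub_sq_le_large ht _ _)
    _ ≤ ENNReal.ofReal 2 * ENNReal.ofReal (6 / m) + ENNReal.ofReal (2 * t ^ 2) := by
        rw [lintegral_add_right _ measurable_const, lintegral_const_mul _ (by fun_prop),
          lintegral_const, measure_univ, mul_one]
        gcongr
        exact lintegral_sampleMean_sub_sq_le hG hm θ i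
    _ = _ := by
        rw [← ENNReal.ofReal_mul (by norm_num), ← ENNReal.ofReal_add (by positivity) (by positivity)]
        congr 1; ring

lemma lintegral_softThresh_le_small (hG : ∀ θ : ℕ → ℝ, IsGaussianSeq θ (G θ)) {m : ℕ}
    (hm : 0 < m) (θ : ℕ → ℝ) (i : ℕ) {t a : ℝ} (ht : 0 ≤ t) (ha : 0 < a) :
    ∫⁻ x, ENNReal.ofReal ((softThresh t (sampleMean m x i) - θ i) ^ 2) ∂(iidSamples m (G θ)) ≤
      ENNReal.ofReal (2 * θ i ^ 2 + 8 / a ^ 2 * Real.exp (a ^ 2 / (2 * m) - a * t)) := by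
  have := (hG θ).1
  have := isProbabilityMeasure_iidSamples m (G θ)
  have hmeas : Measurable fun x => softThresh t (sampleMean m x i - θ i) :=
    (measurable_softThresh t).comp ((measurable_sampleMean m i).sub_const _)
  calc _ ≤ ∫⁻ x, (ENNReal.ofReal (2 * θ i ^ 2) + ENNReal.ofReal 2 *
          ENNReal.ofReal (softThresh t (sampleMean m x i - θ i) ^ 2)) ∂(iidSamples m (G θ)) := by
        refine lintegral_mono fun x => ?_
        rw [← ENNReal.ofReal_mul (by norm_num), ← ENNReal.ofReal_add (by positivity) (by positivity)]
        exact ENNReal.ofReal_le_ofReal (softThresh_sub_sq_le_small ht _ _)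
    _ ≤ ENNReal.ofReal (2 * θ i ^ 2) + ENNReal.ofReal 2 *
          ENNReal.ofReal (4 / a ^ 2 * Real.exp (a ^ 2 / (2 * m) - a * t)) := by
        rw [lintegral_add_left measurable_const, lintegral_const_mul _ (by fun_prop),
          lintegral_const, measure_univ, mul_one]
        gcongr
        exact lintegral_softThresh_noise_le hG hm θ i ht ha
    _ = _ := by
        rw [← ENNReal.ofReal_mul (by norm_num), ← ENNReal.ofReal_add (by positivity) (by positivity)]
        congr 1; ring

/-- The estimator that soft-thresholds the sample mean on `A` and vanishes off `A`. -/
noncomputable def softEst (A : Finset ℕ) (t : ℝ) (m : ℕ) (x : Fin m → ℕ → ℝ) (i : ℕ) : ℝ :=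
  if i ∈ A then softThresh t (sampleMean m x i) else 0

lemma measurable_softEst (A : Finset ℕ) (t : ℝ) (m : ℕ) : Measurable (softEst A t m) := by
  refine measurable_pi_lambda _ fun i => ?_
  unfold softEst
  split_ifs
  · exact (measurable_softThresh t).comp (measurable_sampleMean m i)
  · exact measurable_const

lemma lintegral_softEst_le (A : Finset ℕ) (t : ℝ) (m : ℕ) (θ : SeqL2)
    (μ : Measure (Fin m → ℕ → ℝ)) [IsProbabilityMeasure μ] (r : ℕ → ℝ) (hr0 : ∀ i ∈ A, 0 ≤ r i)
    (hr : ∀ i ∈ A, ∫⁻ x, ENNReal.ofReal ((softThresh t (sampleMean m x i) - θ i) ^ 2) ∂μ ≤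
      ENNReal.ofReal (r i)) :
    ∫⁻ x, (∑' i, ENNReal.ofReal ((softEst A t m x i - θ i) ^ 2)) ∂μ ≤
      ENNReal.ofReal (∑ i ∈ A, r i + (‖θ‖ ^ 2 - ∑ i ∈ A, θ i ^ 2)) := by
  classical
  have htail : HasSum (fun i => if i ∈ A then 0 else θ i ^ 2) (‖θ‖ ^ 2 - ∑ i ∈ A, θ i ^ 2) := by
    have h1 : HasSum (fun i => if i ∈ A then θ i ^ 2 else 0) (∑ i ∈ A, θ i ^ 2) := by
      have h0 : ∑ i ∈ A, θ i ^ 2 = ∑ i ∈ A, if i ∈ A then θ i ^ 2 else 0 :=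
        Finset.sum_congr rfl fun i hi => by simp [hi]
      rw [h0]
      exact hasSum_sum_of_ne_finset_zero fun i hi => by simp [hi]
    convert! (SeqL2.hasSum_sq θ).sub h1 using 2 with i
    split_ifs <;> ring
  have hnn : ∀ i, 0 ≤ (if i ∈ A then 0 else θ i ^ 2) := fun i => by split_ifs <;> positivity
  have htail0 : 0 ≤ ‖θ‖ ^ 2 - ∑ i ∈ A, θ i ^ 2 := htail.nonneg hnn
  have hpt : ∀ x, ∑' i, ENNReal.ofReal ((softEst A t m x i - θ i) ^ 2) =
      ∑ i ∈ A, ENNReal.ofReal ((softThresh t (sampleMean m x i) - θ i) ^ 2) +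
        ENNReal.ofReal (‖θ‖ ^ 2 - ∑ i ∈ A, θ i ^ 2) := by
    intro x
    rw [← htail.tsum_eq, ENNReal.ofReal_tsum_of_nonneg hnn htail.summable]
    have h2 : ∑ i ∈ A, ENNReal.ofReal ((softThresh t (sampleMean m x i) - θ i) ^ 2) =
        ∑' i, if i ∈ A then ENNReal.ofReal ((softThresh t (sampleMean m x i) - θ i) ^ 2)
          else 0 := by
      rw [tsum_eq_sum (s := A) fun i hi => by simp [hi]]
      exact Finset.sum_congr rfl fun i hi => by simp [hi]
    rw [h2, ← ENNReal.tsum_add]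
    refine tsum_congr fun i => ?_
    by_cases hi : i ∈ A <;> simp [softEst, hi]
  have hmeas : ∀ i, Measurable fun x : Fin m → ℕ → ℝ =>
      ENNReal.ofReal ((softThresh t (sampleMean m x i) - θ i) ^ 2) := fun i =>
    ((((measurable_softThresh t).comp (measurable_sampleMean m i)).sub_const _).pow_const
      2).ennreal_ofReal
  simp_rw [hpt]
  rw [lintegral_add_right _ measurable_const, lintegral_const, measure_univ, mul_one,
    lintegral_finsetSum _ fun i _ => hmeas i,
    ENNReal.ofReal_add (Finset.sum_nonneg hr0) htail0, ENNReal.ofReal_sum_of_nonneg hr0]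
  gcongr with i hi
  exact hr i hi

end Estimation

section TestExistence

variable {G : (ℕ → ℝ) → Measure (ℕ → ℝ)}

lemma measure_sum_sq_noise_ge_le (hG : ∀ θ : ℕ → ℝ, IsGaussianSeq θ (G θ)) {n : ℕ} (hn : 0 < n)
    (A : Finset ℕ) (θ : ℕ → ℝ) {c : ℝ} (hc : 0 < c) (hnc : 24 * (A.card : ℝ) ≤ n * c) :
    (iidSamples n (G θ)) {x | c ≤ ∑ i ∈ A, (sampleMean n x i - θ i) ^ 2} ≤ 1 / 4 := by
  have hn' : (0 : ℝ) < n := by positivity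
  have hmeas := measurable_sampleMean n
  have hset : {x : Fin n → ℕ → ℝ | c ≤ ∑ i ∈ A, (sampleMean n x i - θ i) ^ 2} =
      {x | ENNReal.ofReal c ≤ ∑ i ∈ A, ENNReal.ofReal ((sampleMean n x i - θ i) ^ 2)} := by
    ext x
    simp only [Set.mem_ofPred_eq]
    rw [← ENNReal.ofReal_sum_of_nonneg fun i _ => sq_nonneg _,
      ENNReal.ofReal_le_ofReal_iff (Finset.sum_nonneg fun i _ => sq_nonneg _)]
  rw [hset]
  refine (meas_ge_le_lintegral_div (by fun_prop) (by simpa using hc) ENNReal.ofReal_ne_top).trans ?_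
  have hmean : ∫⁻ x, ∑ i ∈ A, ENNReal.ofReal ((sampleMean n x i - θ i) ^ 2) ∂(iidSamples n (G θ)) ≤
      ENNReal.ofReal (A.card * (6 / n)) := by
    rw [lintegral_finsetSum _ fun i _ => by fun_prop]
    calc _ ≤ ∑ _i ∈ A, ENNReal.ofReal (6 / n) :=
          Finset.sum_le_sum fun i _ => lintegral_sampleMean_sub_sq_le hG hn θ i
      _ = _ := by
          rw [Finset.sum_const, nsmul_eq_mul, ENNReal.ofReal_mul (by positivity),
            ENNReal.ofReal_natCast]
  calc _ ≤ ENNReal.ofReal (A.card * (6 / n)) / ENNReal.ofReal c := by gcongr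
    _ = ENNReal.ofReal (A.card * (6 / n) / c) := (ENNReal.ofReal_div_of_pos hc).symm
    _ ≤ ENNReal.ofReal (1 / 4) := by
        apply ENNReal.ofReal_le_ofReal
        rw [div_le_iff₀ hc, mul_div_assoc', div_le_iff₀ hn']
        linarith
    _ = 1 / 4 := by rw [ENNReal.ofReal_div_of_pos (by norm_num)]; simp

/-- Goodness-of-fit testing over a compact set is possible with finitely many samples. -/
lemma exists_gof_test (hG : ∀ θ : ℕ → ℝ, IsGaussianSeq θ (G θ)) {Γ : Set SeqL2}
    (hcomp : IsCompact Γ) {r : ℝ} (hr : 0 < r) :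
    ∃ n : ℕ, ∃ ψ : (Fin n → (ℕ → ℝ)) → Bool, Measurable ψ ∧
      (iidSamples n (G 0)) {x | ψ x = true} ≤ 1 / 4 ∧
      ∀ θ ∈ Γ, r ≤ ‖θ‖ → (iidSamples n (G ⇑θ)) {x | ψ x = false} ≤ 1 / 4 := by
  classical
  obtain ⟨A, hA⟩ := exists_finset_norm_sq_lt hcomp (δ := r ^ 2 / 2) (by positivity)
  have hc : 0 < r ^ 2 / 8 := by positivity
  obtain ⟨n, hn⟩ := exists_nat_ge (24 * (A.card : ℝ) / (r ^ 2 / 8))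
  have hnc : 24 * (A.card : ℝ) ≤ (n + 1 : ℕ) * (r ^ 2 / 8) := by
    rw [div_le_iff₀ hc] at hn
    push_cast
    nlinarith
  have hmeas := measurable_sampleMean (n + 1)
  have hset : MeasurableSet {x : Fin (n + 1) → ℕ → ℝ |
      r ^ 2 / 8 ≤ ∑ i ∈ A, sampleMean (n + 1) x i ^ 2} :=
    measurableSet_le measurable_const (by fun_prop)
  refine ⟨n + 1, fun x => decide (r ^ 2 / 8 ≤ ∑ i ∈ A, sampleMean (n + 1) x i ^ 2), ?_, ?_, ?_⟩
  · refine measurable_to_bool ?_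
    convert! hset using 1
    ext x; simp
  · have h := measure_sum_sq_noise_ge_le hG n.succ_pos A 0 hc hnc
    simpa using h
  · intro θ hθ hrθ
    refine (measure_mono fun x hx => ?_).trans
      (measure_sum_sq_noise_ge_le hG n.succ_pos A θ hc hnc)
    simp only [Set.mem_ofPred_eq, decide_eq_false_iff_not, not_le] at hx ⊢
    have h1 := hA θ hθ
    have h2 : r ^ 2 ≤ ‖θ‖ ^ 2 := by gcongr
    have h3 : ∑ i ∈ A, θ i ^ 2 ≤ 2 * ∑ i ∈ A, sampleMean (n + 1) x i ^ 2 +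
        2 * ∑ i ∈ A, (sampleMean (n + 1) x i - θ i) ^ 2 := by
      rw [Finset.mul_sum, Finset.mul_sum, ← Finset.sum_add_distrib]
      refine Finset.sum_le_sum fun i _ => ?_
      nlinarith [sq_nonneg (2 * sampleMean (n + 1) x i - θ i)]
    linarith

end TestExistence

section SampleComplexity

variable {G : (ℕ → ℝ) → Measure (ℕ → ℝ)} {Γ : Set SeqL2}

/-- If a solid set contains a vector whose energy truncated at level `K` is at least `r ^ 2`, then
testing at separation `r` is impossible with too few samples. -/
lemma one_lt_sq_mul_of_le_sum_min (hG : ∀ θ : ℕ → ℝ, IsGaussianSeq θ (G θ))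
    (hconv : Convex ℝ Γ) (horth : OrthosymmetricSeq Γ) {n : ℕ} {r : ℝ} (hr : 0 < r)
    (ψ : (Fin n → (ℕ → ℝ)) → Bool) (hψ : Measurable ψ)
    (h0 : (iidSamples n (G 0)) {x | ψ x = true} ≤ 1 / 4)
    (h1 : ∀ θ ∈ Γ, r ≤ ‖θ‖ → (iidSamples n (G ⇑θ)) {x | ψ x = false} ≤ 1 / 4)
    {θ : SeqL2} (hθ : θ ∈ Γ) (A : Finset ℕ) {K : ℝ} (hK : 0 ≤ K)
    (hsum : r ^ 2 ≤ ∑ i ∈ A, min (θ i ^ 2) K) : 1 < (n : ℝ) ^ 2 * (K * r ^ 2) := by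
  set q := ∑ i ∈ A, min (θ i ^ 2) K with hq
  have hq0 : 0 < q := lt_of_lt_of_le (by positivity) hsum
  have hc1 : r ^ 2 / q ≤ 1 := (div_le_one hq0).2 hsum
  have hc0 : 0 ≤ r ^ 2 / q := by positivity
  have hmin : ∀ i, 0 ≤ min (θ i ^ 2) K := fun i => le_min (sq_nonneg _) hK
  set η : ℕ → ℝ := fun i => if i ∈ A then √(min (θ i ^ 2) K * (r ^ 2 / q)) else 0 with hη
  have hηsq : ∀ i ∈ A, η i ^ 2 = min (θ i ^ 2) K * (r ^ 2 / q) := fun i hi => by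
    simp only [hη, if_pos hi]
    exact Real.sq_sqrt (mul_nonneg (hmin i) hc0)
  have hηle : ∀ i ∈ A, η i ^ 2 ≤ min (θ i ^ 2) K := fun i hi => by
    rw [hηsq i hi]
    exact mul_le_of_le_one_right (hmin i) hc1
  have hηoff : ∀ i ∉ A, η i = 0 := fun i hi => by simp only [hη, if_neg hi]
  have hηsum : ∑ i ∈ A, η i ^ 2 = r ^ 2 := by
    rw [Finset.sum_congr rfl hηsq, ← Finset.sum_mul, ← hq]
    field_simp
  have hsign : ∀ t i, signVec η t i ^ 2 = η i ^ 2 := fun t i => by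
    rcases signVec_eq_or η t i with h | h <;> rw [h]
    ring
  have hsoff : ∀ t, ∀ i ∉ A, signVec η t i = 0 := fun t i hi => by
    rw [← sq_eq_zero_iff, hsign, hηoff i hi]; ring
  have hcoe : ∀ t, ⇑(SeqL2.ofFinset A (signVec η t)) = signVec η t := fun t => by
    funext i
    rw [SeqL2.ofFinset_apply]
    split_ifs with hi
    · rfl
    · exact (hsoff t i hi).symm
  have key := one_lt_sq_mul_sum_pow_four hG n A η hηoff ψ hψ h0 fun t _ => by
    rw [← hcoe t]
    refine h1 _ (horth.mem_of_abs_le hconv hθ A (fun i hi => ?_) fun i hi => ?_) ?_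
    · rw [hcoe t, ← sq_le_sq, hsign]
      exact (hηle i hi).trans (min_le_left _ _)
    · rw [hcoe t]; exact hsoff t i hi
    · have h : ‖SeqL2.ofFinset A (signVec η t)‖ ^ 2 = r ^ 2 := by
        rw [SeqL2.norm_sq_eq_sum (A := A) fun i hi => by rw [hcoe t]; exact hsoff t i hi, hcoe t,
          ← hηsum]
        exact Finset.sum_congr rfl fun i _ => hsign t i
      exact le_of_sq_le_sq h.ge (norm_nonneg _)
  refine key.trans_le ?_
  gcongr
  rw [← hηsum, Finset.mul_sum]
  refine Finset.sum_le_sum fun i hi => ?_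
  calc η i ^ 4 = η i ^ 2 * η i ^ 2 := by ring
    _ ≤ K * η i ^ 2 := by
      gcongr
      exact (hηle i hi).trans (min_le_right _ _)

lemma le_sum_min_of_le_sum {A : Finset ℕ} {f : ℕ → ℝ} (hf : ∀ i, 0 ≤ f i) {K : ℝ} (hK : 0 ≤ K)
    (h : K ≤ ∑ i ∈ A, f i) : K ≤ ∑ i ∈ A, min (f i) K := by
  by_cases hex : ∃ i ∈ A, K ≤ f i
  · obtain ⟨i, hi, hKi⟩ := hex
    calc K = min (f i) K := (min_eq_right hKi).symm
      _ ≤ _ := Finset.single_le_sum (f := fun i => min (f i) K) (fun j _ => le_min (hf j) hK) hi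
  · push Not at hex
    rwa [Finset.sum_congr rfl fun i hi => min_eq_left (hex i hi).le]

lemma SeqL2.norm_sq_le_sum_add {θ : SeqL2} {A : Finset ℕ} {δ : ℝ}
    (h : ∑' i : {i : ℕ // i ∉ A}, θ (i : ℕ) ^ 2 ≤ δ) : ‖θ‖ ^ 2 ≤ ∑ i ∈ A, θ i ^ 2 + δ := by
  have hs := SeqL2.hasSum_sq θ
  rw [← hs.tsum_eq, ← hs.summable.sum_add_tsum_subtype_compl A]
  gcongr

/-- Soft thresholding at the universal threshold over `A` estimates, up to constants, as well as
the oracle that keeps only the coordinates above the noise level. -/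
lemma lintegral_softThresh_le_min (hG : ∀ θ : ℕ → ℝ, IsGaussianSeq θ (G θ)) {m D : ℕ}
    (hm : 0 < m) (hD : 0 < D) {K : ℝ}
    (hK : (12 + 4 * Real.log (2 * D)) / m ≤ 2 * K) (θ : ℕ → ℝ) (i : ℕ) :
    ∫⁻ x, ENNReal.ofReal ((softThresh (√(2 * Real.log (2 * D) / m)) (sampleMean m x i) - θ i) ^ 2)
        ∂(iidSamples m (G θ)) ≤
      ENNReal.ofReal (2 * min (θ i ^ 2) K + 2 / (Real.log (2 * D) * m * D)) := by
  have hD' : (1 : ℝ) ≤ D := by exact_mod_cast hD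
  have hm' : (0 : ℝ) < m := by exact_mod_cast hm
  set L := Real.log (2 * D) with hLdef
  have hL : 0 < L := Real.log_pos (by linarith)
  have ht : 0 ≤ √(2 * L / m) := Real.sqrt_nonneg _
  have htsq : √(2 * L / m) ^ 2 = 2 * L / m := Real.sq_sqrt (by positivity)
  rcases le_total (θ i ^ 2) K with h | h
  · rw [min_eq_left h]
    have ha : 0 < √(2 * L * m) := Real.sqrt_pos.2 (by positivity)
    refine (lintegral_softThresh_le_small hG hm θ i ht ha).trans (ENNReal.ofReal_le_ofReal ?_)
    have hasq : √(2 * L * m) ^ 2 = 2 * L * m := Real.sq_sqrt (by positivity)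
    have hat : √(2 * L * m) * √(2 * L / m) = 2 * L := by
      rw [← Real.sqrt_mul (by positivity),
        show 2 * L * m * (2 * L / m) = (2 * L) ^ 2 by field_simp, Real.sqrt_sq (by positivity)]
    rw [hat, hasq, show 2 * L * m / (2 * m) - 2 * L = -L by field_simp; ring, Real.exp_neg,
      hLdef, Real.exp_log (by linarith), ← hLdef]
    refine le_of_eq ?_
    field_simp
    ring
  · rw [min_eq_right h]
    refine (lintegral_softThresh_le_large hG hm θ i ht).trans (ENNReal.ofReal_le_ofReal ?_)
    have : 0 ≤ 2 / (L * m * D) := by positivity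
    rw [htsq]
    have e : 12 / (m : ℝ) + 2 * (2 * L / m) = (12 + 4 * L) / m := by ring
    linarith

/-- If every element of `Γ` has small truncated energy on `A` and a small tail off `A`, then `Γ` can
be estimated by soft thresholding. -/
lemma nEstSeq_le (hG : ∀ θ : ℕ → ℝ, IsGaussianSeq θ (G θ)) {A : Finset ℕ} {ε K : ℝ} {m : ℕ}
    (hA : 0 < A.card) (hm : 0 < m)
    (htail : ∀ θ ∈ Γ, ‖θ‖ ^ 2 ≤ ∑ i ∈ A, θ i ^ 2 + ε ^ 2)
    (hK0 : 0 ≤ K) (hK : (12 + 4 * Real.log (2 * A.card)) / m ≤ 2 * K)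
    (htrunc : ∀ θ ∈ Γ, ∑ i ∈ A, min (θ i ^ 2) K ≤ ε ^ 2 / 2)
    (hbias : 2 / (Real.log (2 * A.card) * m) ≤ ε ^ 2) : nEstSeq G Γ (√3 * ε) ≤ m := by
  refine Nat.sInf_le ⟨softEst A (√(2 * Real.log (2 * A.card) / m)) m, measurable_softEst _ _ _,
    fun θ hθ => ?_⟩
  have hA' : (1 : ℝ) ≤ A.card := by exact_mod_cast hA
  have hL : 0 < Real.log (2 * A.card) := Real.log_pos (by linarith)
  have := (hG θ).1
  have := isProbabilityMeasure_iidSamples m (G θ)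
  refine (lintegral_softEst_le A _ m θ _
    (fun i => 2 * min (θ i ^ 2) K + 2 / (Real.log (2 * A.card) * m * A.card)) (fun i _ => ?_)
    fun i _ => lintegral_softThresh_le_min hG hm hA hK θ i).trans (ENNReal.ofReal_le_ofReal ?_)
  · have := le_min (sq_nonneg (θ i)) hK0
    positivity
  · rw [Finset.sum_add_distrib, ← Finset.mul_sum, Finset.sum_const, nsmul_eq_mul, mul_pow,
      Real.sq_sqrt (by norm_num)]
    have e : (A.card : ℝ) * (2 / (Real.log (2 * A.card) * m * A.card)) =
        2 / (Real.log (2 * A.card) * m) := by field_simp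
    rw [e]
    linarith [htail θ hθ, htrunc θ hθ]

lemma nEstSeq_eq_zero (hG : ∀ θ : ℕ → ℝ, IsGaussianSeq θ (G θ)) {r : ℝ}
    (h : ∀ θ ∈ Γ, ‖θ‖ ^ 2 ≤ r ^ 2) : nEstSeq G Γ r = 0 := by
  refine Nat.sInf_eq_zero.2 (Or.inl ⟨softEst ∅ 0 0, measurable_softEst _ _ _, fun θ hθ => ?_⟩)
  have := (hG θ).1
  have := isProbabilityMeasure_iidSamples 0 (G θ)
  refine (lintegral_softEst_le ∅ 0 0 θ _ 0 (by simp) (by simp)).trans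
    (ENNReal.ofReal_le_ofReal ?_)
  simpa using h θ hθ

end SampleComplexity

/-- For a compact, convex, orthosymmetric `Γ ⊆ ℓ²(ℕ)`,
`n_gof(Γ, ε/√2)² ≥ (1/(64 log(2 D_c(Γ, ε)))) · n_est(Γ, √3 ε)/ε²`. -/
theorem gof_lower_bound_from_est_seq (G : (ℕ → ℝ) → Measure (ℕ → ℝ))
    (hG : ∀ θ : ℕ → ℝ, IsGaussianSeq θ (G θ))
    (Γ : Set SeqL2) (hcomp : IsCompact Γ) (hconv : Convex ℝ Γ)
    (horth : OrthosymmetricSeq Γ) (ε : ℝ) (hε : 0 < ε) :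
    (1 / (64 * Real.log (2 * (kolDimCoord Γ ε : ℝ))))
        * ((nEstSeq G Γ (Real.sqrt 3 * ε) : ℝ) / ε ^ 2)
      ≤ (nGofSeq G Γ (ε / Real.sqrt 2) : ℝ) ^ 2 := by
  rcases Nat.eq_zero_or_pos (kolDimCoord Γ ε) with hD0 | hDpos
  · rw [hD0]
    simp only [Nat.cast_zero, mul_zero, Real.log_zero, div_zero, zero_mul]
    positivity
  obtain ⟨A, hcard, htail'⟩ := Nat.sInf_mem (Nat.nonempty_of_pos_sInf hDpos)
  change A.card = kolDimCoord Γ ε at hcard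
  rw [← hcard] at hDpos ⊢
  have htail : ∀ θ ∈ Γ, ‖θ‖ ^ 2 ≤ ∑ i ∈ A, θ i ^ 2 + ε ^ 2 := fun θ hθ =>
    SeqL2.norm_sq_le_sum_add (htail' θ hθ)
  have hr : 0 < ε / √2 := by positivity
  have hrsq : (ε / √2) ^ 2 = ε ^ 2 / 2 := by rw [div_pow, Real.sq_sqrt (by norm_num)]
  obtain ⟨ψ, hψ, h0, h1⟩ := Nat.sInf_mem (exists_gof_test hG hcomp hr)
  change Measurable ψ at hψ
  set n : ℕ := nGofSeq G Γ (ε / √2) with hn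
  have htest : ∀ θ ∈ Γ, ∀ K : ℝ, 0 ≤ K → ε ^ 2 / 2 ≤ ∑ i ∈ A, min (θ i ^ 2) K →
      1 < (n : ℝ) ^ 2 * (K * (ε ^ 2 / 2)) := fun θ hθ K hK hs => by
    rw [← hrsq] at hs ⊢
    exact one_lt_sq_mul_of_le_sum_min hG hconv horth hr ψ hψ h0 h1 hθ A hK hs
  by_cases hsmall : ∀ θ ∈ Γ, ‖θ‖ ^ 2 ≤ (√3 * ε) ^ 2
  · rw [nEstSeq_eq_zero hG hsmall]
    simp only [Nat.cast_zero, zero_div, mul_zero]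
    positivity
  push Not at hsmall
  obtain ⟨θ₀, hθ₀, hbig⟩ := hsmall
  rw [mul_pow, Real.sq_sqrt (by norm_num)] at hbig
  have hn2 : 1 < (n : ℝ) ^ 2 * (ε ^ 2 / 2 * (ε ^ 2 / 2)) :=
    htest θ₀ hθ₀ _ (by positivity) (le_sum_min_of_le_sum (fun i => sq_nonneg _) (by positivity)
      (by nlinarith [htail θ₀ hθ₀, sq_nonneg ε]))
  have hn0 : (0 : ℝ) < n := by
    rcases (Nat.cast_nonneg n : (0 : ℝ) ≤ n).eq_or_lt with h | h
    · rw [← h] at hn2; norm_num at hn2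
    · exact h
  have hnε : 2 < n * ε ^ 2 := by
    refine lt_of_pow_lt_pow_left₀ 2 (by positivity) ?_
    nlinarith
  have hA1 : (1 : ℝ) ≤ A.card := by exact_mod_cast hDpos
  set L := Real.log (2 * A.card) with hLdef
  have hL : 0.69 < L := by
    have : Real.log 2 ≤ L := Real.log_le_log (by norm_num) (by linarith)
    linarith [Real.log_two_gt_d9]
  have hn1 : (1 : ℝ) ≤ n := by exact_mod_cast (Nat.cast_pos.1 hn0 : 0 < n)
  set Y := (n : ℝ) ^ 2 * ε ^ 2 with hY
  have hYn : 2 < Y := by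
    rw [hY]; nlinarith
  have hLY : 1 < L * Y := by nlinarith
  set m : ℕ := ⌊64 * (L * Y)⌋₊ with hm
  have hmle : (m : ℝ) ≤ 64 * (L * Y) := Nat.floor_le (by linarith)
  have hmge : 32 * (L * Y) ≤ m := by
    have := Nat.lt_floor_add_one (64 * (L * Y))
    linarith
  have hm0 : (0 : ℝ) < m := by linarith
  have hest : nEstSeq G Γ (√3 * ε) ≤ m := by
    refine nEstSeq_le (K := 2 / Y) hG hDpos (Nat.cast_pos.1 hm0) htail (by positivity) ?_ ?_ ?_
    · rw [← hLdef, div_le_iff₀ hm0]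
      have h : 2 * (2 / Y) * (32 * (L * Y)) ≤ 2 * (2 / Y) * m := by gcongr
      have e : 2 * (2 / Y) * (32 * (L * Y)) = 128 * L := by field_simp; norm_num
      linarith
    · intro θ hθ
      by_contra! hcon
      have h := htest θ hθ (2 / Y) (by positivity) hcon.le
      have e : (n : ℝ) ^ 2 * (2 / Y * (ε ^ 2 / 2)) = 1 := by
        rw [hY]; field_simp
      linarith
    · rw [← hLdef, div_le_iff₀ (by positivity)]
      have h : ε ^ 2 * (L * (32 * (L * Y))) ≤ ε ^ 2 * (L * m) := by gcongr
      have e : ε ^ 2 * (L * (32 * (L * Y))) = 32 * (L * (n * ε ^ 2)) ^ 2 := by rw [hY]; ring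
      have h2 : 1 < L * (n * ε ^ 2) := by nlinarith
      nlinarith
  have hest' : (nEstSeq G Γ (√3 * ε) : ℝ) ≤ 64 * (L * Y) :=
    le_trans (by exact_mod_cast hest) hmle
  rw [div_mul_div_comm, one_mul, div_le_iff₀ (by positivity)]
  linarith [show (n : ℝ) ^ 2 * (64 * L * ε ^ 2) = 64 * (L * Y) by rw [hY]; ring]
end

section
/- Let Γ = {θ = (θ₁, θ₂, …) ∈ ℓ²(ℕ) : Σ_{i≥1} i·|θ_i| ≤ 1}. There exist constants c > 0, C > 0 and ε₀ ∈ (0,1) such that for every ε ∈ (0, ε₀), c·ε^{−8/3} ≤ n_est(Γ, ε) ≤ C·ε^{−8/3}·log(1/ε). In particular, n_est(Γ, ε) ≥ ε^{−8/3}/4 and n_est(Γ, ε) ≤ 4·(ε/8)^{−8/3}·log(1/ε) for all sufficiently small ε. -/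
open MeasureTheory ProbabilityTheory Real
open scoped RealInnerProductSpace ENNReal

/-- The body `Γ = {θ ∈ ℓ²(ℕ) : Σ_{i ≥ 1} i·|θ_i| ≤ 1}` (coordinates indexed from `0`, so
coordinate `i` carries weight `i + 1`). -/
noncomputable def counterBody : Set SeqL2 :=
  {θ : SeqL2 | (∑' i : ℕ, ENNReal.ofReal (((i : ℝ) + 1) * |θ i|)) ≤ 1}

/-- Changing finitely many factors of an infinite product measure by densities multiplies the
product measure by the product of these densities. -/
lemma infinitePi_eq_withDensity_prod {ι : Type*} {X : ι → Type*} [∀ i, MeasurableSpace (X i)]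
    (μ ν : ∀ i, Measure (X i)) [∀ i, IsProbabilityMeasure (μ i)] [∀ i, IsProbabilityMeasure (ν i)]
    (s : Finset ι) (f : ∀ i, X i → ℝ≥0∞) (hf : ∀ i, Measurable (f i))
    (hs : ∀ i ∈ s, ν i = (μ i).withDensity (f i)) (hs' : ∀ i ∉ s, ν i = μ i) :
    Measure.infinitePi ν = (Measure.infinitePi μ).withDensity (fun x => ∏ i ∈ s, f i (x i)) := by
  classical
  symm
  refine Measure.eq_infinitePi _ fun u t ht => ?_
  set g : ∀ i, X i → ℝ≥0∞ := fun i x =>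
    (if i ∈ s then f i x else 1) * (if i ∈ u then (t i).indicator 1 x else 1) with hg
  have hgm : ∀ i, Measurable (g i) := by
    intro i
    refine Measurable.mul ?_ ?_
    · split_ifs
      exacts [hf i, measurable_const]
    · split_ifs
      exacts [measurable_one.indicator (ht i), measurable_const]
  have hbox : MeasurableSet ((u : Set ι).pi t) := .pi u.countable_toSet fun i _ => ht i
  have hprod : ∀ x : ∀ i, X i,
      ((u : Set ι).pi t).indicator (fun x => ∏ i ∈ s, f i (x i)) x
        = ∏ i ∈ s ∪ u, g i (x i) := by
    intro x
    have hind : ((u : Set ι).pi t).indicator (1 : (∀ i, X i) → ℝ≥0∞) x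
        = ∏ i ∈ u, (t i).indicator 1 (x i) := by
      by_cases hx : x ∈ (u : Set ι).pi t
      · rw [Set.indicator_of_mem hx]
        refine (Finset.prod_eq_one fun i hi => ?_).symm
        rw [Set.indicator_of_mem (hx i hi)]
        rfl
      · rw [Set.indicator_of_notMem hx]
        simp only [Set.mem_pi, not_forall] at hx
        obtain ⟨i, hi, hit⟩ := hx
        exact (Finset.prod_eq_zero hi (Set.indicator_of_notMem hit _)).symm
    calc ((u : Set ι).pi t).indicator (fun x => ∏ i ∈ s, f i (x i)) x
        = (∏ i ∈ s, f i (x i)) * ((u : Set ι).pi t).indicator 1 x := by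
          by_cases hx : x ∈ (u : Set ι).pi t
          · rw [Set.indicator_of_mem hx, Set.indicator_of_mem hx]; simp
          · rw [Set.indicator_of_notMem hx, Set.indicator_of_notMem hx]; simp
      _ = ∏ i ∈ s ∪ u, g i (x i) := by
          rw [hind, hg]
          simp only [Finset.prod_mul_distrib, Finset.prod_ite_mem, Finset.union_inter_cancel_left,
            Finset.union_inter_cancel_right]
  rw [withDensity_apply _ hbox, ← lintegral_indicator hbox]
  simp_rw [hprod]
  rw [lintegral_prod_eq_prod_lintegral_of_indepFun (s ∪ u)
    (fun i (x : ∀ i, X i) => g i (x i))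
    (iIndepFun_infinitePi hgm) (fun i => (hgm i).comp (measurable_pi_apply i))]
  have hfac : ∀ i ∈ s ∪ u, ∫⁻ x, g i (x i) ∂(Measure.infinitePi μ)
      = if i ∈ u then ν i (t i) else 1 := by
    intro i _
    have h1 : ∫⁻ x, g i (x i) ∂(Measure.infinitePi μ)
        = ∫⁻ y, (if i ∈ u then (t i).indicator 1 y else 1) ∂(ν i) := by
      rw [(measurePreserving_eval_infinitePi μ i).lintegral_comp (hgm i)]
      by_cases hi : i ∈ s
      · rw [hs i hi, lintegral_withDensity_eq_lintegral_mul _ (hf i)]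
        · simp [hg, hi]
        · split_ifs
          exacts [measurable_one.indicator (ht i), measurable_const]
      · rw [hs' i hi]
        simp [hg, hi]
    rw [h1]
    split_ifs
    · exact lintegral_indicator_one (ht i)
    · simp
  rw [Finset.prod_congr rfl hfac, Finset.prod_ite_mem, Finset.union_inter_cancel_right]

/-- The likelihood ratio of `N(a + h, 1)` with respect to `N(a, 1)`. -/
noncomputable def shiftDensity (a h x : ℝ) : ℝ≥0∞ :=
  ENNReal.ofReal (Real.exp (h * (x - a) - h ^ 2 / 2))

lemma measurable_shiftDensity (a h : ℝ) : Measurable (shiftDensity a h) := by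
  unfold shiftDensity
  fun_prop

lemma gaussianReal_add_eq_withDensity (a h : ℝ) :
    gaussianReal (a + h) 1 = (gaussianReal a 1).withDensity (shiftDensity a h) := by
  rw [gaussianReal_of_var_ne_zero _ one_ne_zero, gaussianReal_of_var_ne_zero _ one_ne_zero,
    ← withDensity_mul _ (measurable_gaussianPDF a 1) (measurable_shiftDensity a h)]
  congr 1
  ext x
  rw [Pi.mul_apply, gaussianPDF, gaussianPDF, shiftDensity,
    ← ENNReal.ofReal_mul (gaussianPDFReal_nonneg _ _ _)]
  congr 1
  simp only [gaussianPDFReal_def]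
  rw [mul_assoc _ (Real.exp _) (Real.exp _), ← Real.exp_add]
  congr 2
  push_cast
  ring

lemma IsGaussianSeq.update_eq_withDensity {θ : ℕ → ℝ} {ν ν' : Measure (ℕ → ℝ)} {i : ℕ} {h : ℝ}
    (hν : IsGaussianSeq θ ν) (hν' : IsGaussianSeq (Function.update θ i (θ i + h)) ν') :
    ν' = ν.withDensity (fun x => shiftDensity (θ i) h (x i)) := by
  rw [hν.eq_infinitePi, hν'.eq_infinitePi]
  rw [infinitePi_eq_withDensity_prod (fun k => gaussianReal (θ k) 1) _ {i}
    (fun k => shiftDensity (θ k) h) (fun k => measurable_shiftDensity _ _)]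
  · simp
  · simp [gaussianReal_add_eq_withDensity]
  · intro k hk
    rw [Finset.mem_singleton] at hk
    simp [Function.update_of_ne hk]

instance isProbabilityMeasure_iidSamples_s3 {E : Type*} [MeasurableSpace E] (n : ℕ) (ν : Measure E)
    [IsProbabilityMeasure ν] : IsProbabilityMeasure (iidSamples n ν) := by
  unfold iidSamples
  infer_instance

/-- The likelihood ratio of `n` samples when the mean of coordinate `i` is shifted
from `a` to `a + h`. -/
noncomputable def sampleDensity (n i : ℕ) (a h : ℝ) (x : Fin n → ℕ → ℝ) : ℝ :=
  Real.exp (h * ∑ j, (x j i - a) - n * h ^ 2 / 2)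

lemma measurable_sampleDensity (n i : ℕ) (a h : ℝ) : Measurable (sampleDensity n i a h) := by
  unfold sampleDensity
  fun_prop

lemma iidSamples_update_eq_withDensity (n : ℕ) {θ : ℕ → ℝ} {ν ν' : Measure (ℕ → ℝ)}
    {i : ℕ} {h : ℝ} (hν : IsGaussianSeq θ ν)
    (hν' : IsGaussianSeq (Function.update θ i (θ i + h)) ν') :
    iidSamples n ν' = (iidSamples n ν).withDensity
      (fun x => ENNReal.ofReal (sampleDensity n i (θ i) h x)) := by
  have := hν.1
  have := hν'.1
  unfold iidSamples
  rw [← Measure.infinitePi_eq_pi, ← Measure.infinitePi_eq_pi,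
    infinitePi_eq_withDensity_prod (fun _ => ν) (fun _ => ν') Finset.univ
      (fun _ x => shiftDensity (θ i) h (x i))
      (fun _ => (measurable_shiftDensity _ _).comp (measurable_pi_apply i))
      (fun _ _ => hν.update_eq_withDensity hν') (by simp)]
  congr 1
  ext x
  simp only [shiftDensity, sampleDensity]
  rw [← ENNReal.ofReal_prod_of_nonneg (fun _ _ => (Real.exp_pos _).le), ← Real.exp_sum,
    Finset.sum_sub_distrib, ← Finset.mul_sum]
  simp
  ring_nf

lemma lintegral_sampleDensity (n : ℕ) {θ : ℕ → ℝ} {ν ν' : Measure (ℕ → ℝ)}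
    {i : ℕ} {h : ℝ} (hν : IsGaussianSeq θ ν)
    (hν' : IsGaussianSeq (Function.update θ i (θ i + h)) ν') :
    ∫⁻ x, ENNReal.ofReal (sampleDensity n i (θ i) h x) ∂(iidSamples n ν) = 1 := by
  have := hν'.1
  have h1 : iidSamples n ν' Set.univ = 1 := measure_univ
  rwa [iidSamples_update_eq_withDensity n hν hν', withDensity_apply _ .univ,
    Measure.restrict_univ] at h1

lemma two_point_pointwise (f δ : ℝ) {A B : ℝ} (hA : 0 < A) (hB : 0 < B) :
    4 * δ ^ 2 * (A * B)
      ≤ A * (f - δ) ^ 2 + B * (f + δ) ^ 2 + δ ^ 2 * (A * B) * (A + B) := by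
  have hs : 0 < A + B := by positivity
  have h1 : (A + B) * (A * (f - δ) ^ 2 + B * (f + δ) ^ 2)
      = 4 * δ ^ 2 * (A * B) + (f * (A + B) - δ * (A - B)) ^ 2 := by ring
  refine le_of_mul_le_mul_left ?_ hs
  have h2 : 0 ≤ δ ^ 2 * (A * B) * (A + B - 2) ^ 2 := by positivity
  nlinarith [sq_nonneg (f * (A + B) - δ * (A - B))]

/-- The soft-thresholding function. -/
noncomputable def softThreshold (t y : ℝ) : ℝ := max (y - t) 0 - max (-y - t) 0

lemma measurable_softThreshold (t : ℝ) : Measurable (softThreshold t) := by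
  unfold softThreshold
  fun_prop

lemma sq_softThreshold_sub_le_of_abs_le {t y θ : ℝ} (h : |y - θ| ≤ t) :
    (softThreshold t y - θ) ^ 2 ≤ min (θ ^ 2) ((2 * t) ^ 2) := by
  have ht : 0 ≤ t := (abs_nonneg _).trans h
  obtain ⟨h1, h2⟩ := abs_le.1 h
  unfold softThreshold
  refine le_min (sq_le_sq.2 ?_) (sq_le_sq.2 ?_)
  · rcases max_cases (y - t) 0 with ⟨e, _⟩ | ⟨e, _⟩ <;>
    rcases max_cases (-y - t) 0 with ⟨e', _⟩ | ⟨e', _⟩ <;> rw [e, e'] <;>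
    rcases abs_cases θ with ⟨e'', _⟩ | ⟨e'', _⟩ <;> rw [e'', abs_le] <;> constructor <;> linarith
  · rw [abs_of_nonneg (by positivity : 0 ≤ 2 * t)]
    rcases max_cases (y - t) 0 with ⟨e, _⟩ | ⟨e, _⟩ <;>
    rcases max_cases (-y - t) 0 with ⟨e', _⟩ | ⟨e', _⟩ <;> rw [e, e', abs_le] <;>
    constructor <;> linarith

lemma sq_softThreshold_sub_le_of_lt_abs {t y θ : ℝ} (ht : 0 ≤ t) (h : t < |y - θ|) :
    (softThreshold t y - θ) ^ 2 ≤ 4 * (y - θ) ^ 2 := by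
  have h1 : |softThreshold t y - θ| ≤ t + |y - θ| := by
    unfold softThreshold
    rcases max_cases (y - t) 0 with ⟨e, _⟩ | ⟨e, _⟩ <;>
    rcases max_cases (-y - t) 0 with ⟨e', _⟩ | ⟨e', _⟩ <;> rw [e, e'] <;>
    rcases abs_cases (y - θ) with ⟨e'', _⟩ | ⟨e'', _⟩ <;> rw [e'', abs_le] <;> constructor <;>
    linarith
  have h2 : |softThreshold t y - θ| ≤ |2 * (y - θ)| := by
    rw [abs_mul, abs_two]; linarith
  calc (softThreshold t y - θ) ^ 2 ≤ (2 * (y - θ)) ^ 2 := sq_le_sq.2 h2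
    _ = 4 * (y - θ) ^ 2 := by ring

lemma sq_le_two_mul_exp_of_lt_abs {τ w : ℝ} (hτ : 1 ≤ τ) (h : τ < |w|) :
    w ^ 2 ≤ 2 * Real.exp (τ - τ ^ 2) * (Real.exp (τ * w) + Real.exp (-(τ * w))) := by
  have h1 : |w| ^ 2 ≤ 2 * Real.exp |w| := by
    have := Real.quadratic_le_exp_of_nonneg (abs_nonneg w)
    nlinarith [abs_nonneg w]
  have h2 : Real.exp |w| ≤ Real.exp (τ - τ ^ 2) * Real.exp (τ * |w|) := by
    rw [← Real.exp_add]
    refine Real.exp_le_exp.2 ?_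
    nlinarith
  have h3 : Real.exp (τ * |w|) ≤ Real.exp (τ * w) + Real.exp (-(τ * w)) := by
    rcases abs_cases w with ⟨e, _⟩ | ⟨e, _⟩ <;> rw [e]
    · linarith [Real.exp_pos (-(τ * w))]
    · rw [mul_neg]; linarith [Real.exp_pos (τ * w)]
  rw [← sq_abs]
  have h4 := mul_le_mul_of_nonneg_left h3 (Real.exp_pos (τ - τ ^ 2)).le
  linarith

/-- Error of soft thresholding the mean `θ + S / n` of `n` observations at level `t`. -/
lemma sq_softThreshold_mean_sub_le {n : ℕ} (hn : 0 < n) {t : ℝ} (ht : 0 ≤ t)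
    (hτ : 1 ≤ t * √n) (θ S : ℝ) :
    (softThreshold t (θ + S / n) - θ) ^ 2 ≤ min (θ ^ 2) ((2 * t) ^ 2)
      + 8 / n * Real.exp (t * √n - n * t ^ 2) * (Real.exp (t * S) + Real.exp (-(t * S))) := by
  have hn' : (0 : ℝ) < n := by exact_mod_cast hn
  have hs : 0 < √(n : ℝ) := Real.sqrt_pos.2 hn'
  have hss : √(n : ℝ) * √(n : ℝ) = n := Real.mul_self_sqrt hn'.le
  rcases le_or_gt |θ + S / n - θ| t with h | h
  · exact (sq_softThreshold_sub_le_of_abs_le h).trans (le_add_of_nonneg_right (by positivity))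
  · refine (sq_softThreshold_sub_le_of_lt_abs ht h).trans ?_
    have hm : 0 ≤ min (θ ^ 2) ((2 * t) ^ 2) := by positivity
    rw [add_sub_cancel_left] at h ⊢
    have hw : S / n * √n = S / √n := by
      rw [div_mul_eq_mul_div, div_eq_div_iff hn'.ne' hs.ne', mul_assoc, hss]
    have h1 : t * √n < |S / √n| := by
      rw [← hw, abs_mul, abs_of_pos hs]
      exact mul_lt_mul_of_pos_right h hs
    have h2 := sq_le_two_mul_exp_of_lt_abs hτ h1
    have e1 : t * √n * (S / √n) = t * S := by field_simp
    have e2 : (t * √n) ^ 2 = n * t ^ 2 := by rw [mul_pow, Real.sq_sqrt hn'.le]; ring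
    have e3 : (S / √n) ^ 2 = n * (S / n) ^ 2 := by
      rw [div_pow, Real.sq_sqrt hn'.le]; field_simp
    rw [e1, e2, e3] at h2
    have h3 := mul_le_mul_of_nonneg_left h2 (by positivity : 0 ≤ 4 / (n : ℝ))
    have e4 : 4 / (n : ℝ) * (n * (S / n) ^ 2) = 4 * (S / n) ^ 2 := by field_simp
    rw [e4] at h3
    refine h3.trans (le_trans (le_of_eq ?_) (le_add_of_nonneg_left hm))
    ring

/-- Two-point lower bound: no estimator can estimate coordinate `i` well both at `δ` and `-δ`. -/
lemma two_point_lower_bound {G : (ℕ → ℝ) → Measure (ℕ → ℝ)}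
    (hG : ∀ θ : ℕ → ℝ, IsGaussianSeq θ (G θ)) (n i : ℕ) (δ : ℝ) (θ : ℕ → ℝ) (hθ : θ i = 0)
    {f : (Fin n → ℕ → ℝ) → ℝ} (hf : Measurable f) :
    ENNReal.ofReal (2 * (δ ^ 2 * Real.exp (-(n * δ ^ 2))))
      ≤ ∫⁻ x, ENNReal.ofReal ((f x - δ) ^ 2) ∂(iidSamples n (G (Function.update θ i δ)))
        + ∫⁻ x, ENNReal.ofReal ((f x - -δ) ^ 2)
            ∂(iidSamples n (G (Function.update θ i (-δ)))) := by
  have hup : ∀ h : ℝ, IsGaussianSeq (Function.update θ i (θ i + h)) (G (Function.update θ i h)) :=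
    fun h => by simpa [hθ] using hG (Function.update θ i h)
  set P := iidSamples n (G θ)
  have hP : IsProbabilityMeasure P := by
    have := (hG θ).1
    exact isProbabilityMeasure_iidSamples_s3 n (G θ)
  have hdens : ∀ h : ℝ,
      ∫⁻ x, ENNReal.ofReal ((f x - h) ^ 2) ∂(iidSamples n (G (Function.update θ i h)))
        = ∫⁻ x, ENNReal.ofReal (sampleDensity n i (θ i) h x * (f x - h) ^ 2) ∂P := by
    intro h
    rw [iidSamples_update_eq_withDensity n (hG θ) (hup h),
      lintegral_withDensity_eq_lintegral_mul _ (measurable_sampleDensity n i _ h).ennreal_ofReal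
        (by fun_prop)]
    refine lintegral_congr fun x => ?_
    rw [Pi.mul_apply, ENNReal.ofReal_mul (show 0 ≤ sampleDensity n i (θ i) h x from
      (Real.exp_pos _).le)]
  have hm := measurable_sampleDensity n i (θ i)
  have hone : ∀ h : ℝ, ∫⁻ x, ENNReal.ofReal (sampleDensity n i (θ i) h x) ∂P = 1 :=
    fun h => lintegral_sampleDensity n (hG θ) (hup h)
  set q := δ ^ 2 * Real.exp (-(n * δ ^ 2)) with hq
  have hq0 : 0 ≤ q := by positivity
  have hpt : ∀ x, ENNReal.ofReal (4 * q)
      ≤ ENNReal.ofReal (sampleDensity n i (θ i) δ x * (f x - δ) ^ 2)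
        + ENNReal.ofReal (sampleDensity n i (θ i) (-δ) x * (f x - -δ) ^ 2)
        + ENNReal.ofReal q * (ENNReal.ofReal (sampleDensity n i (θ i) δ x)
          + ENNReal.ofReal (sampleDensity n i (θ i) (-δ) x)) := by
    intro x
    have hA : 0 < sampleDensity n i (θ i) δ x := Real.exp_pos _
    have hB : 0 < sampleDensity n i (θ i) (-δ) x := Real.exp_pos _
    have hAB : sampleDensity n i (θ i) δ x * sampleDensity n i (θ i) (-δ) x
        = Real.exp (-(n * δ ^ 2)) := by
      rw [sampleDensity, sampleDensity, ← Real.exp_add]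
      congr 1
      ring
    have key := two_point_pointwise (f x) δ hA hB
    rw [hAB] at key
    rw [← ENNReal.ofReal_add hA.le hB.le, ← ENNReal.ofReal_mul hq0,
      ← ENNReal.ofReal_add (by positivity) (by positivity),
      ← ENNReal.ofReal_add (by positivity) (by positivity)]
    refine ENNReal.ofReal_le_ofReal ?_
    rw [sub_neg_eq_add, hq]
    linarith
  have hint := lintegral_mono (μ := P) hpt
  rw [lintegral_const, measure_univ, mul_one, lintegral_add_left (by fun_prop),
    lintegral_add_left (by fun_prop), lintegral_const_mul _ (by fun_prop),
    lintegral_add_left (by fun_prop), hone, hone, ← hdens, ← hdens] at hint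
  have e1 : ENNReal.ofReal q * (1 + 1) = ENNReal.ofReal (2 * q) := by
    rw [one_add_one_eq_two, mul_comm, ENNReal.ofReal_mul zero_le_two, ENNReal.ofReal_ofNat]
  have e2 : ENNReal.ofReal (4 * q) = ENNReal.ofReal (2 * q) + ENNReal.ofReal (2 * q) := by
    rw [← ENNReal.ofReal_add (by positivity) (by positivity)]
    ring_nf
  rw [e1, e2] at hint
  exact (ENNReal.add_le_add_iff_right ENNReal.ofReal_ne_top).1 hint

/-- The vertex of the cube `{-δ, δ}^d × {0}^∞` with signs given by `v`. -/
noncomputable def cubeVertex {d : ℕ} (δ : ℝ) (v : Fin d → Bool) (k : ℕ) : ℝ :=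
  if h : k < d then (if v ⟨k, h⟩ then δ else -δ) else 0

lemma abs_cubeVertex {d : ℕ} {δ : ℝ} (hδ : 0 ≤ δ) (v : Fin d → Bool) (k : ℕ) :
    |cubeVertex δ v k| = if k < d then δ else 0 := by
  unfold cubeVertex
  split_ifs <;> simp [abs_of_nonneg hδ]

lemma cubeVertex_eq_update {d : ℕ} (δ : ℝ) (v : Fin d → Bool) (i : Fin d) :
    cubeVertex δ v = Function.update (Function.update (cubeVertex δ v) i 0) i
      (if v i then δ else -δ) := by
  ext k
  by_cases hk : k = i
  · subst hk; simp [cubeVertex]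
  · simp [hk]

lemma cubeVertex_update {d : ℕ} (δ : ℝ) (v : Fin d → Bool) (i : Fin d) (b : Bool) :
    cubeVertex δ (Function.update v i b) = Function.update (Function.update (cubeVertex δ v) i 0) i
      (if b then δ else -δ) := by
  ext k
  by_cases hk : k = i
  · subst hk; simp [cubeVertex]
  · have : ∀ h : k < d, (⟨k, h⟩ : Fin d) ≠ i := fun h e => hk (by rw [← e])
    simp [cubeVertex, hk, this]

lemma exists_mem_counterBody_of_cubeVertex {d : ℕ} {δ : ℝ} (hδ : 0 ≤ δ)
    (hd : δ * (d * (d + 1)) ≤ 2) (v : Fin d → Bool) :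
    ∃ θ ∈ counterBody, ⇑θ = cubeVertex δ v := by
  have hmem : Memℓp (cubeVertex δ v) 2 := by
    refine (memℓp_zero ?_).of_exponent_ge (zero_le)
    refine (Set.finite_lt_nat d).subset fun k hk => ?_
    by_contra hkd
    exact hk (by simp [cubeVertex, show ¬ k < d from hkd])
  refine ⟨⟨cubeVertex δ v, hmem⟩, ?_, rfl⟩
  change ∑' k : ℕ, ENNReal.ofReal (((k : ℝ) + 1) * |cubeVertex δ v k|) ≤ 1
  rw [tsum_eq_sum (s := Finset.range d)]
  · rw [← ENNReal.ofReal_sum_of_nonneg (fun k _ => by positivity), ← ENNReal.ofReal_one]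
    refine ENNReal.ofReal_le_ofReal ?_
    have h1 : ∑ k ∈ Finset.range d, ((k : ℝ) + 1) * |cubeVertex δ v k|
        = (∑ k ∈ Finset.range d, ((k : ℝ) + 1)) * δ := by
      rw [Finset.sum_mul]
      refine Finset.sum_congr rfl fun k hk => ?_
      rw [abs_cubeVertex hδ, if_pos (Finset.mem_range.1 hk)]
    have h2 : ∀ m : ℕ, ∑ k ∈ Finset.range m, ((k : ℝ) + 1) = m * (m + 1) / 2 := by
      intro m
      induction m with
      | zero => simp
      | succ m ih => rw [Finset.sum_range_succ, ih]; push_cast; ring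
    rw [h1, h2]
    linarith
  · intro k hk
    rw [abs_cubeVertex hδ, if_neg (by simpa using hk)]
    simp

/-- Lower bound for the worst-case risk over `counterBody` by averaging over a cube. -/
lemma cube_lower_bound {G : (ℕ → ℝ) → Measure (ℕ → ℝ)}
    (hG : ∀ θ : ℕ → ℝ, IsGaussianSeq θ (G θ)) {n d : ℕ} {δ r : ℝ} (hδ : 0 ≤ δ) (hr : 0 ≤ r)
    (hd : δ * (d * (d + 1)) ≤ 2)
    {est : (Fin n → (ℕ → ℝ)) → (ℕ → ℝ)} (hest : Measurable est)
    (hrisk : ∀ θ ∈ counterBody,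
      (∫⁻ x, (∑' i, ENNReal.ofReal ((est x i - θ i) ^ 2)) ∂(iidSamples n (G ⇑θ)))
        ≤ ENNReal.ofReal r) :
    d * (δ ^ 2 * Real.exp (-(n * δ ^ 2))) ≤ r := by
  set q := δ ^ 2 * Real.exp (-(n * δ ^ 2)) with hq
  have hq0 : 0 ≤ q := by positivity
  have hestm : ∀ i, Measurable fun x => est x i := fun i => (measurable_pi_apply i).comp hest
  let F : Fin d → (Fin d → Bool) → ℝ≥0∞ := fun i v =>
    ∫⁻ x, ENNReal.ofReal ((est x i - cubeVertex δ v i) ^ 2) ∂(iidSamples n (G (cubeVertex δ v)))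
  have hF : ∀ v, ∑ i, F i v ≤ ENNReal.ofReal r := by
    intro v
    obtain ⟨θ, hθ, e⟩ := exists_mem_counterBody_of_cubeVertex hδ hd v
    have h1 := hrisk θ hθ
    rw [e] at h1
    refine le_trans ?_ h1
    have hm : ∀ i : Fin d,
        Measurable fun x => ENNReal.ofReal ((est x i - cubeVertex δ v i) ^ 2) :=
      fun i => by have := hestm i; fun_prop
    rw [← lintegral_finsetSum _ fun i _ => hm i]
    refine lintegral_mono fun x => ?_
    rw [Fin.sum_univ_eq_sum_range
      (fun i => ENNReal.ofReal ((est x i - cubeVertex δ v i) ^ 2)) d]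
    exact ENNReal.sum_le_tsum _
  let flip : Fin d → (Fin d → Bool) → (Fin d → Bool) := fun i v => Function.update v i (!v i)
  have hflip : ∀ i, Function.Involutive (flip i) := by
    intro i v
    simp [flip]
  have hpair : ∀ i v, ENNReal.ofReal (2 * q) ≤ F i v + F i (flip i v) := by
    intro i v
    have key := two_point_lower_bound hG n i δ (Function.update (cubeVertex δ v) i 0)
      (by simp) (hestm i)
    have e1 := cubeVertex_eq_update δ v i
    have e2 := cubeVertex_update δ v i (!v i)
    simp only [F, flip]
    cases hv : v i
    · simp only [hv, Bool.not_false, if_true, Bool.false_eq_true, if_false] at e1 e2 ⊢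
      rw [add_comm, e2, e1]
      simpa using key
    · simp only [hv, Bool.not_true, if_true, Bool.false_eq_true, if_false] at e1 e2 ⊢
      rw [e2, e1]
      simpa using key
  have hcoord : ∀ i, (2 ^ d : ℝ≥0∞) * ENNReal.ofReal (2 * q) ≤ 2 * ∑ v, F i v := by
    intro i
    calc (2 ^ d : ℝ≥0∞) * ENNReal.ofReal (2 * q)
        = ∑ _v : Fin d → Bool, ENNReal.ofReal (2 * q) := by simp
      _ ≤ ∑ v, (F i v + F i (flip i v)) := Finset.sum_le_sum fun v _ => hpair i v
      _ = 2 * ∑ v, F i v := by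
        rw [Finset.sum_add_distrib, (hflip i).bijective.sum_comp (F i), two_mul]
  have htotal : (2 ^ d : ℝ≥0∞) * (d * ENNReal.ofReal (2 * q))
      ≤ (2 ^ d : ℝ≥0∞) * (2 * ENNReal.ofReal r) := by
    calc (2 ^ d : ℝ≥0∞) * (d * ENNReal.ofReal (2 * q))
        = ∑ _i : Fin d, (2 ^ d : ℝ≥0∞) * ENNReal.ofReal (2 * q) := by simp; ring
      _ ≤ ∑ i, 2 * ∑ v, F i v := Finset.sum_le_sum fun i _ => hcoord i
      _ = 2 * ∑ v, ∑ i, F i v := by rw [← Finset.mul_sum, Finset.sum_comm]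
      _ ≤ 2 * ∑ _v : Fin d → Bool, ENNReal.ofReal r := by
        gcongr with v
        exact hF v
      _ = (2 ^ d : ℝ≥0∞) * (2 * ENNReal.ofReal r) := by simp; ring
  rw [ENNReal.mul_le_mul_iff_right (by simp) (by simp)] at htotal
  have e1 : (d : ℝ≥0∞) * ENNReal.ofReal (2 * q) = ENNReal.ofReal (d * (2 * q)) := by
    rw [ENNReal.ofReal_mul (Nat.cast_nonneg d), ENNReal.ofReal_natCast]
  have e2 : 2 * ENNReal.ofReal r = ENNReal.ofReal (2 * r) := by
    rw [ENNReal.ofReal_mul zero_le_two, ENNReal.ofReal_ofNat]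
  rw [e1, e2, ENNReal.ofReal_le_ofReal_iff (by positivity)] at htotal
  linarith

lemma lintegral_exp_mul_sum {G : (ℕ → ℝ) → Measure (ℕ → ℝ)}
    (hG : ∀ θ : ℕ → ℝ, IsGaussianSeq θ (G θ)) (n i : ℕ) (h : ℝ) (θ : ℕ → ℝ) :
    ∫⁻ x, ENNReal.ofReal (Real.exp (h * ∑ j, (x j i - θ i))) ∂(iidSamples n (G θ))
      = ENNReal.ofReal (Real.exp (n * h ^ 2 / 2)) := by
  have e : ∀ x : Fin n → ℕ → ℝ, ENNReal.ofReal (Real.exp (h * ∑ j, (x j i - θ i)))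
      = ENNReal.ofReal (Real.exp (n * h ^ 2 / 2))
        * ENNReal.ofReal (sampleDensity n i (θ i) h x) := by
    intro x
    rw [← ENNReal.ofReal_mul (Real.exp_pos _).le, sampleDensity, ← Real.exp_add]
    congr 2
    ring
  simp_rw [e]
  rw [lintegral_const_mul _ (measurable_sampleDensity n i (θ i) h).ennreal_ofReal,
    lintegral_sampleDensity n (hG θ) (hG _), mul_one]

/-- Soft thresholding of the empirical means of the first `K` coordinates. -/
noncomputable def thresholdEstimator (n K : ℕ) (t : ℝ) (x : Fin n → ℕ → ℝ) (i : ℕ) : ℝ :=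
  if i < K then softThreshold t ((∑ j, x j i) / n) else 0

lemma measurable_thresholdEstimator (n K : ℕ) (t : ℝ) :
    Measurable (thresholdEstimator n K t) := by
  refine measurable_pi_lambda _ fun i => ?_
  unfold thresholdEstimator
  split_ifs
  · exact (measurable_softThreshold t).comp (by fun_prop)
  · exact measurable_const

lemma risk_softThreshold_le {G : (ℕ → ℝ) → Measure (ℕ → ℝ)}
    (hG : ∀ θ : ℕ → ℝ, IsGaussianSeq θ (G θ)) {n : ℕ} (hn : 0 < n) (i : ℕ) {t : ℝ}
    (ht : 0 ≤ t) (hτ : 1 ≤ t * √n) (θ : ℕ → ℝ) :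
    ∫⁻ x, ENNReal.ofReal ((softThreshold t ((∑ j, x j i) / n) - θ i) ^ 2) ∂(iidSamples n (G θ))
      ≤ ENNReal.ofReal (min (θ i ^ 2) ((2 * t) ^ 2))
        + ENNReal.ofReal (16 / n * Real.exp (t * √n - n * t ^ 2 / 2)) := by
  have := (hG θ).1
  have hn' : (n : ℝ) ≠ 0 := by exact_mod_cast hn.ne'
  set b := 8 / n * Real.exp (t * √n - n * t ^ 2) with hb
  have hb0 : 0 ≤ b := by positivity
  have hpt : ∀ x : Fin n → ℕ → ℝ,
      ENNReal.ofReal ((softThreshold t ((∑ j, x j i) / n) - θ i) ^ 2)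
        ≤ ENNReal.ofReal (min (θ i ^ 2) ((2 * t) ^ 2))
          + ENNReal.ofReal b * (ENNReal.ofReal (Real.exp (t * ∑ j, (x j i - θ i)))
            + ENNReal.ofReal (Real.exp (-t * ∑ j, (x j i - θ i)))) := by
    intro x
    have e : (∑ j, x j i) / n = θ i + (∑ j, (x j i - θ i)) / n := by
      rw [Finset.sum_sub_distrib]
      simp
      field_simp
      ring
    rw [e, ← ENNReal.ofReal_add (by positivity) (by positivity), ← ENNReal.ofReal_mul hb0,
      ← ENNReal.ofReal_add (by positivity) (by positivity), neg_mul]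
    exact ENNReal.ofReal_le_ofReal (sq_softThreshold_mean_sub_le hn ht hτ _ _)
  refine (lintegral_mono hpt).trans ?_
  rw [lintegral_add_left measurable_const, lintegral_const, measure_univ, mul_one,
    lintegral_const_mul _ (by fun_prop), lintegral_add_left (by fun_prop),
    lintegral_exp_mul_sum hG, lintegral_exp_mul_sum hG, neg_sq]
  gcongr
  rw [← ENNReal.ofReal_add (by positivity) (by positivity), ← ENNReal.ofReal_mul hb0]
  refine ENNReal.ofReal_le_ofReal (le_of_eq ?_)
  have e : Real.exp (t * √n - n * t ^ 2 / 2)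
      = Real.exp (t * √n - n * t ^ 2) * Real.exp (n * t ^ 2 / 2) := by
    rw [← Real.exp_add]; ring_nf
  rw [e, hb]
  ring

lemma tsum_min_sq_le {θ : SeqL2} (hθ : θ ∈ counterBody) {T : ℝ} (hT : 0 ≤ T) (m : ℕ) :
    ∑' i, ENNReal.ofReal (min (θ i ^ 2) (T ^ 2)) ≤ ENNReal.ofReal (m * T ^ 2 + T / (m + 1)) := by
  have hpt : ∀ i, ENNReal.ofReal (min (θ i ^ 2) (T ^ 2))
      ≤ (if i < m then ENNReal.ofReal (T ^ 2) else 0)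
        + ENNReal.ofReal (T / (m + 1)) * ENNReal.ofReal (((i : ℝ) + 1) * |θ i|) := by
    intro i
    split_ifs with hi
    · exact (ENNReal.ofReal_le_ofReal (min_le_right _ _)).trans le_self_add
    · rw [zero_add, ← ENNReal.ofReal_mul (by positivity)]
      refine ENNReal.ofReal_le_ofReal ?_
      have h1 : min (θ i ^ 2) (T ^ 2) ≤ T * |θ i| := by
        rw [← sq_abs (θ i)]
        rcases le_total |θ i| T with h | h
        · exact (min_le_left _ _).trans (by nlinarith [abs_nonneg (θ i)])
        · exact (min_le_right _ _).trans (by nlinarith)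
      have h2 : (m : ℝ) + 1 ≤ i + 1 := by
        have : (m : ℝ) ≤ i := by exact_mod_cast not_lt.1 hi
        linarith
      refine h1.trans ?_
      rw [div_mul_eq_mul_div, le_div_iff₀ (by positivity)]
      have := mul_le_mul_of_nonneg_left h2 (mul_nonneg hT (abs_nonneg (θ i)))
      linarith
  refine (ENNReal.tsum_le_tsum hpt).trans ?_
  rw [ENNReal.tsum_add, ENNReal.tsum_mul_left,
    ENNReal.ofReal_add (by positivity) (by positivity)]
  refine add_le_add (le_of_eq ?_) (mul_le_of_le_one_right (zero_le) hθ)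
  rw [tsum_eq_sum (s := Finset.range m) (by simp +contextual)]
  rw [Finset.sum_congr rfl fun i hi => if_pos (Finset.mem_range.1 hi)]
  simp [ENNReal.ofReal_mul]

lemma abs_le_inv_of_mem_counterBody {θ : SeqL2} (hθ : θ ∈ counterBody) (i : ℕ) :
    |θ i| ≤ 1 / (i + 1) := by
  have h1 : ENNReal.ofReal (((i : ℝ) + 1) * |θ i|) ≤ 1 :=
    (ENNReal.le_tsum (f := fun i : ℕ => ENNReal.ofReal (((i : ℝ) + 1) * |θ i|)) i).trans hθ
  rw [ENNReal.ofReal_le_one] at h1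
  rw [le_div_iff₀ (by positivity)]
  linarith

lemma risk_thresholdEstimator_le {G : (ℕ → ℝ) → Measure (ℕ → ℝ)}
    (hG : ∀ θ : ℕ → ℝ, IsGaussianSeq θ (G θ)) {n K : ℕ} (hn : 0 < n) {t : ℝ}
    (ht : 0 ≤ t) (hτ : 1 ≤ t * √n) (hK : 1 ≤ K * (2 * t)) (m : ℕ) {θ : SeqL2}
    (hθ : θ ∈ counterBody) :
    ∫⁻ x, (∑' i, ENNReal.ofReal ((thresholdEstimator n K t x i - θ i) ^ 2))
        ∂(iidSamples n (G ⇑θ))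
      ≤ ENNReal.ofReal (m * (2 * t) ^ 2 + 2 * t / (m + 1)
          + K * (16 / n * Real.exp (t * √n - n * t ^ 2 / 2))) := by
  have := (hG θ).1
  set R := 16 / n * Real.exp (t * √n - n * t ^ 2 / 2) with hR
  have hR0 : 0 ≤ R := by positivity
  have hmeas : ∀ i, Measurable fun x =>
      ENNReal.ofReal ((thresholdEstimator n K t x i - θ i) ^ 2) := by
    intro i
    have := (measurable_pi_apply i).comp (measurable_thresholdEstimator n K t)
    exact ((this.sub_const (θ i)).pow_const 2).ennreal_ofReal
  rw [lintegral_tsum fun i => (hmeas i).aemeasurable]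
  have hpt : ∀ i, ∫⁻ x, ENNReal.ofReal ((thresholdEstimator n K t x i - θ i) ^ 2)
        ∂(iidSamples n (G ⇑θ))
      ≤ ENNReal.ofReal (min (θ i ^ 2) ((2 * t) ^ 2)) + if i < K then ENNReal.ofReal R else 0 := by
    intro i
    by_cases hi : i < K
    · simp only [thresholdEstimator, if_pos hi]
      exact risk_softThreshold_le hG hn i ht hτ θ
    · simp only [thresholdEstimator, if_neg hi, add_zero, zero_sub, neg_sq, lintegral_const,
        measure_univ, mul_one]
      refine ENNReal.ofReal_le_ofReal (le_min le_rfl ?_)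
      rw [sq_le_sq, abs_of_nonneg (by positivity : 0 ≤ 2 * t)]
      refine (abs_le_inv_of_mem_counterBody hθ i).trans ?_
      rw [div_le_iff₀ (by positivity)]
      have : (K : ℝ) ≤ i := by exact_mod_cast not_lt.1 hi
      nlinarith
  refine (ENNReal.tsum_le_tsum hpt).trans ?_
  rw [ENNReal.tsum_add, ENNReal.ofReal_add (by positivity) (by positivity)]
  refine add_le_add (tsum_min_sq_le hθ (by positivity) m) (le_of_eq ?_)
  rw [tsum_eq_sum (s := Finset.range K) (by simp +contextual)]
  rw [Finset.sum_congr rfl fun i hi => if_pos (Finset.mem_range.1 hi)]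
  simp [ENNReal.ofReal_mul]

/-- Soft thresholding attains risk `u ^ 6` over `counterBody`, once `n` is of order
`u⁻⁸ log(1/u)`. -/
lemma exists_estimator_of_le {G : (ℕ → ℝ) → Measure (ℕ → ℝ)}
    (hG : ∀ θ : ℕ → ℝ, IsGaussianSeq θ (G θ)) {u L : ℝ} (hu : 0 < u) (hu1 : u ≤ 1)
    (hL : 2 ≤ L) (huL : Real.exp (-L) = u ^ 3) {n : ℕ} (hn : 512 * L ≤ n * u ^ 8) :
    ∃ est : (Fin n → (ℕ → ℝ)) → (ℕ → ℝ), Measurable est ∧ ∀ θ ∈ counterBody,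
      (∫⁻ x, (∑' i, ENNReal.ofReal ((est x i - θ i) ^ 2)) ∂(iidSamples n (G ⇑θ)))
        ≤ ENNReal.ofReal (u ^ 6) := by
  have hn0 : (0 : ℝ) < n := by
    by_contra h
    have : (n : ℝ) * u ^ 8 ≤ 0 := mul_nonpos_of_nonpos_of_nonneg (not_lt.1 h) (by positivity)
    linarith
  set t := u ^ 4 / 8 with ht
  have ht0 : 0 ≤ t := by positivity
  set τ := t * √n with hτ
  have hτ0 : 0 ≤ τ := by positivity
  have hτsq : τ ^ 2 = n * t ^ 2 := by rw [hτ, mul_pow, Real.sq_sqrt hn0.le]; ring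
  have hnt : n * t ^ 2 = n * u ^ 8 / 64 := by rw [ht]; ring
  have hτ4 : 4 ≤ τ := by nlinarith
  set K := ⌈4 / u ^ 4⌉₊
  have hK1 : 4 / u ^ 4 ≤ K := Nat.le_ceil _
  have hK2 : (K : ℝ) < 4 / u ^ 4 + 1 := Nat.ceil_lt_add_one (by positivity)
  have hKu : (K : ℝ) * u ^ 4 ≤ 5 := by
    have h1 : u ^ 4 ≤ 1 := pow_le_one₀ hu.le hu1
    have h2 : (4 / u ^ 4 + 1) * u ^ 4 = 4 + u ^ 4 := by field_simp
    nlinarith [mul_le_mul_of_nonneg_right hK2.le (by positivity : 0 ≤ u ^ 4)]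
  have hKt : 1 ≤ K * (2 * t) := by
    rw [div_le_iff₀ (by positivity)] at hK1
    rw [ht]
    linarith
  set m := ⌊2 / u ^ 2⌋₊
  have hm1 : (m : ℝ) * u ^ 2 ≤ 2 := by
    have : (m : ℝ) ≤ 2 / u ^ 2 := Nat.floor_le (by positivity)
    rwa [le_div_iff₀ (by positivity)] at this
  have hm2 : 2 ≤ ((m : ℝ) + 1) * u ^ 2 := by
    have : 2 / u ^ 2 < (m : ℝ) + 1 := Nat.lt_floor_add_one _
    rw [div_lt_iff₀ (by positivity)] at this
    exact this.le
  refine ⟨thresholdEstimator n K t, measurable_thresholdEstimator n K t, fun θ hθ => ?_⟩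
  refine (risk_thresholdEstimator_le hG (by exact_mod_cast hn0) ht0 (by linarith) hKt m hθ).trans
    (ENNReal.ofReal_le_ofReal ?_)
  have h1 : m * (2 * t) ^ 2 ≤ u ^ 6 / 8 := by
    have : m * (2 * t) ^ 2 = m * u ^ 2 * (u ^ 6 / 16) := by rw [ht]; ring
    rw [this]
    nlinarith [pow_pos hu 6]
  have h2 : 2 * t / (m + 1) ≤ u ^ 6 / 8 := by
    rw [div_le_iff₀ (by positivity), ht]
    nlinarith [pow_pos hu 4]
  have h3 : Real.exp (τ - n * t ^ 2 / 2) ≤ u ^ 6 := by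
    calc Real.exp (τ - n * t ^ 2 / 2) ≤ Real.exp (-L + -L) := Real.exp_le_exp.2 (by nlinarith)
      _ = u ^ 6 := by rw [Real.exp_add, huL]; ring
  have h4 : 16 / (n : ℝ) ≤ u ^ 8 / 64 := by
    rw [div_le_iff₀ hn0]
    linarith
  have h5 : K * (16 / n * Real.exp (τ - n * t ^ 2 / 2)) ≤ u ^ 6 / 2 := by
    calc K * (16 / n * Real.exp (τ - n * t ^ 2 / 2))
        ≤ K * (u ^ 8 / 64 * u ^ 6) := by gcongr
      _ = (K * u ^ 4) * u ^ 4 / 64 * u ^ 6 := by ring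
      _ ≤ 5 * 1 / 64 * u ^ 6 := by
        gcongr
        exact pow_le_one₀ hu.le hu1
      _ ≤ u ^ 6 / 2 := by nlinarith [pow_pos hu 6]
  nlinarith [pow_pos hu 6]

/-- Risk `u ^ 6` over `counterBody` requires at least `u⁻⁸ / 4` samples. -/
lemma le_of_exists_estimator {G : (ℕ → ℝ) → Measure (ℕ → ℝ)}
    (hG : ∀ θ : ℕ → ℝ, IsGaussianSeq θ (G θ)) {u : ℝ} (hu : 0 < u) (hu1 : u ≤ 1 / 4) {n : ℕ}
    {est : (Fin n → (ℕ → ℝ)) → (ℕ → ℝ)} (hest : Measurable est)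
    (hrisk : ∀ θ ∈ counterBody,
      (∫⁻ x, (∑' i, ENNReal.ofReal ((est x i - θ i) ^ 2)) ∂(iidSamples n (G ⇑θ)))
        ≤ ENNReal.ofReal (u ^ 6)) :
    1 / u ^ 8 / 4 ≤ n := by
  by_contra! hn
  have hnu : n * (2 * u ^ 4) ^ 2 ≤ 1 := by
    rw [div_div, lt_div_iff₀ (by positivity)] at hn
    nlinarith
  have hu2 : u ^ 2 ≤ 1 / 16 := by nlinarith
  obtain ⟨d, hd⟩ : ∃ d, ⌊1 / u ^ 2⌋₊ = d + 1 := by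
    refine Nat.exists_eq_succ_of_ne_zero (Nat.floor_pos.2 ?_).ne'
    rw [le_div_iff₀ (by positivity)]
    linarith
  have hd1 : ((d : ℝ) + 1) * u ^ 2 ≤ 1 := by
    have : ((d + 1 : ℕ) : ℝ) ≤ 1 / u ^ 2 := hd ▸ Nat.floor_le (by positivity)
    rw [le_div_iff₀ (by positivity)] at this
    exact_mod_cast this
  have hd2 : 1 ≤ ((d : ℝ) + 2) * u ^ 2 := by
    have : 1 / u ^ 2 < ((d + 1 : ℕ) : ℝ) + 1 := hd ▸ Nat.lt_floor_add_one _
    rw [div_lt_iff₀ (by positivity)] at this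
    push_cast at this
    linarith
  have hcube : 2 * u ^ 4 * (d * (d + 1)) ≤ 2 := by
    have h1 : (d : ℝ) * u ^ 2 ≤ 1 := by nlinarith [pow_pos hu 2]
    have h2 : (d * u ^ 2) * ((d + 1) * u ^ 2) ≤ 1 := mul_le_one₀ h1 (by positivity) hd1
    nlinarith
  have key := cube_lower_bound hG (by positivity) (by positivity) hcube hest hrisk
  have hexp : 1 / 3 ≤ Real.exp (-(n * (2 * u ^ 4) ^ 2)) := by
    calc (1 : ℝ) / 3 ≤ Real.exp (-1) := by
          rw [Real.exp_neg, one_div]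
          exact inv_anti₀ (Real.exp_pos 1) (by linarith [Real.exp_one_lt_d9])
      _ ≤ _ := Real.exp_le_exp.2 (by linarith)
  have h1 : d * ((2 * u ^ 4) ^ 2 * (1 / 3)) ≤ u ^ 6 := le_trans (by gcongr) key
  have h2 : d * ((2 * u ^ 4) ^ 2 * (1 / 3)) = (d * u ^ 2) * (4 / 3) * u ^ 6 := by ring
  rw [h2] at h1
  nlinarith [pow_pos hu 6]

/-- For `Γ = {θ : Σ_i i |θ_i| ≤ 1}`, the estimation sample complexity is
`Θ̃(ε^{−8/3})`: bounded between `c ε^{−8/3}` and `C ε^{−8/3} log(1/ε)`, and in particular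
between `ε^{−8/3}/4` and `4 (ε/8)^{−8/3} log(1/ε)`, for small `ε`. -/
theorem counterexample_est_rate (G : (ℕ → ℝ) → Measure (ℕ → ℝ))
    (hG : ∀ θ : ℕ → ℝ, IsGaussianSeq θ (G θ)) :
    ∃ c C ε₀ : ℝ, 0 < c ∧ 0 < C ∧ ε₀ ∈ Set.Ioo (0 : ℝ) 1 ∧
      ∀ ε : ℝ, ε ∈ Set.Ioo (0 : ℝ) ε₀ →
        (c * ε ^ (-(8 : ℝ)/3) ≤ (nEstSeq G counterBody ε : ℝ) ∧
         (nEstSeq G counterBody ε : ℝ) ≤ C * ε ^ (-(8 : ℝ)/3) * Real.log (1/ε) ∧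
         ε ^ (-(8 : ℝ)/3) / 4 ≤ (nEstSeq G counterBody ε : ℝ) ∧
         (nEstSeq G counterBody ε : ℝ) ≤ 4 * (ε/8) ^ (-(8 : ℝ)/3) * Real.log (1/ε)) := by
  refine ⟨1 / 4, 1024, 1 / 100, by norm_num, by norm_num, by norm_num, fun ε ⟨hε, hε1⟩ => ?_⟩
  obtain ⟨u, hu, rfl⟩ : ∃ u : ℝ, 0 < u ∧ u ^ 3 = ε :=
    ⟨ε ^ (1 / 3 : ℝ), by positivity, by
      rw [← Real.rpow_natCast, ← Real.rpow_mul hε.le]; norm_num⟩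
  have hu4 : u ≤ 1 / 4 := by
    by_contra! h
    have := pow_lt_pow_left₀ h (by norm_num) (three_ne_zero)
    norm_num at this
    linarith
  have hpow : ∀ v : ℝ, 0 < v → (v ^ 3) ^ (-(8 : ℝ) / 3) = 1 / v ^ 8 := by
    intro v hv
    rw [← Real.rpow_natCast v 3, ← Real.rpow_mul hv.le, one_div, ← Real.rpow_natCast v 8,
      ← Real.rpow_neg hv.le]
    norm_num
  have hpow' : (u ^ 3 / 8) ^ (-(8 : ℝ) / 3) = 256 * (1 / u ^ 8) := by
    rw [show u ^ 3 / 8 = (u / 2) ^ 3 by ring, hpow _ (by positivity)]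
    field_simp
    norm_num
  rw [hpow u hu, hpow']
  set L := Real.log (1 / u ^ 3) with hLdef
  have hexpL : Real.exp (-L) = u ^ 3 := by
    rw [hLdef, one_div, Real.log_inv, neg_neg, Real.exp_log (by positivity)]
  have hL : 2 ≤ L := by
    rw [hLdef, Real.le_log_iff_exp_le (by positivity), le_div_iff₀ (by positivity)]
    have h1 : Real.exp 2 = Real.exp 1 * Real.exp 1 := by rw [← Real.exp_add]; norm_num
    have h2 : Real.exp 2 ≤ 9 := by
      rw [h1]
      nlinarith [Real.exp_one_lt_d9, Real.exp_pos 1]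
    nlinarith
  have h8 : 1 ≤ 1 / u ^ 8 := by
    rw [le_div_iff₀ (by positivity), one_mul]
    exact pow_le_one₀ hu.le (by linarith)
  set N := ⌈512 * L * (1 / u ^ 8)⌉₊
  have hN : 512 * L ≤ N * u ^ 8 := by
    have : 512 * L * (1 / u ^ 8) ≤ N := Nat.le_ceil _
    rwa [mul_one_div, div_le_iff₀ (by positivity)] at this
  have hN' : (N : ℝ) ≤ 1024 * (1 / u ^ 8) * L := by
    have : (N : ℝ) < 512 * L * (1 / u ^ 8) + 1 := Nat.ceil_lt_add_one (by positivity)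
    nlinarith
  have hsq : (u ^ 3) ^ 2 = u ^ 6 := by ring
  have hmem := exists_estimator_of_le hG hu (by linarith) hL hexpL hN
  rw [← hsq] at hmem
  have hupper : (nEstSeq G counterBody (u ^ 3) : ℝ) ≤ 1024 * (1 / u ^ 8) * L :=
    le_trans (by exact_mod_cast Nat.sInf_le hmem) hN'
  have hlower : 1 / u ^ 8 / 4 ≤ (nEstSeq G counterBody (u ^ 3) : ℝ) := by
    obtain ⟨est, hest, hrisk⟩ := Nat.sInf_mem
      (s := {n : ℕ | ∃ est : (Fin n → (ℕ → ℝ)) → (ℕ → ℝ), Measurable est ∧ ∀ θ ∈ counterBody,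
        (∫⁻ x, (∑' i, ENNReal.ofReal ((est x i - θ i) ^ 2)) ∂(iidSamples n (G ⇑θ)))
          ≤ ENNReal.ofReal ((u ^ 3) ^ 2)}) ⟨N, hmem⟩
    exact le_of_exists_estimator hG hu hu4 hest fun θ hθ => (hrisk θ hθ).trans_eq (by rw [hsq])
  exact ⟨by linarith, hupper, hlower, by linarith⟩
end
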